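/- arXiv:1606.06486 — 3 statements merged into one kernel-verified Lean document; each statement's English description precedes it below -/
import Mathlib

section
/- Let n ≥ 1 and let H be a closed subgroup of Sp(1,n) acting ℍ-irreducibly on ℍ^{n+1}, and let H⁰ denote the identity component of H. Then at least one of the following holds: (i) H⁰ is trivial (i.e. H is discrete); (ii) H⁰ is conjugate in Sp(1,n) to U(1)·𝟙 or to Sp(1)·𝟙; (iii) H⁰ acts ℍ-irreducibly on ℍ^{n+1}; (iv) n = 1 and H⁰ is conjugate in Sp(1,1) to one of the groups {B(t) : t ∈ ℝ}, {λ·B(t) : t ∈ ℝ, λ ∈ span_ℝ{1,i}, |λ| = 1}, {q·B(t) : t ∈ ℝ, q ∈ ℍ, |q| = 1}, or S_{a,b} := {(cos(bt) + sin(bt)·i)·B(at) : t ∈ ℝ} for some nonzero real numbers a, b. -/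
/- Statement 1: possibilities for the identity component of a closed ℍ-irreducible
subgroup of Sp(1,n). -/

open Quaternion Matrix Pointwise

noncomputable section

/-- The quaternions over ℝ. -/
abbrev Quat := Quaternion ℝ

/-- The imaginary unit `i` of the quaternions. -/
def qi : Quat := ⟨0, 1, 0, 0⟩

/-- The matrix η = diag(-1,1,…,1). -/
def eta (n : ℕ) : Matrix (Fin (n + 1)) (Fin (n + 1)) Quat :=
  Matrix.diagonal fun i => if i = 0 then -1 else 1

/-- Sp(1,n) as a set of quaternionic matrices. -/
def Sp (n : ℕ) : Set (Matrix (Fin (n + 1)) (Fin (n + 1)) Quat) :=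
  {A | Aᴴ * eta n * A = eta n}

/-- A set of quaternionic matrices acts ℍ-irreducibly on ℍ^{n+1}: the only invariant
right ℍ-submodules are `⊥` and `⊤`. -/
def ActsHIrreducibly (n : ℕ) (S : Set (Matrix (Fin (n + 1)) (Fin (n + 1)) Quat)) : Prop :=
  ∀ W : Submodule Quatᵐᵒᵖ (Fin (n + 1) → Quat),
    (∀ A ∈ S, ∀ v ∈ W, A.mulVec v ∈ W) → W = ⊥ ∨ W = ⊤

/-- U(1)·𝟙: unit-norm scalars in span_ℝ{1,i} times the identity. -/
def U1One (n : ℕ) : Set (Matrix (Fin (n + 1)) (Fin (n + 1)) Quat) :=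
  {M | ∃ l : Quat, l.imJ = 0 ∧ l.imK = 0 ∧ ‖l‖ = 1 ∧ M = l • (1 : Matrix (Fin (n + 1)) (Fin (n + 1)) Quat)}

/-- Sp(1)·𝟙: unit quaternions times the identity. -/
def Sp1One (n : ℕ) : Set (Matrix (Fin (n + 1)) (Fin (n + 1)) Quat) :=
  {M | ∃ q : Quat, ‖q‖ = 1 ∧ M = q • (1 : Matrix (Fin (n + 1)) (Fin (n + 1)) Quat)}

/-- The matrix B(t) = [[cosh t, sinh t],[sinh t, cosh t]] (padded by the identity in sizes
larger than 2; for n = 1 this is exactly B(t)). -/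
def Bmat (n : ℕ) (t : ℝ) : Matrix (Fin (n + 1)) (Fin (n + 1)) Quat := fun i j =>
  if (i : ℕ) = 0 ∧ (j : ℕ) = 0 then (Real.cosh t : ℝ)
  else if (i : ℕ) = 1 ∧ (j : ℕ) = 1 then (Real.cosh t : ℝ)
  else if ((i : ℕ) = 0 ∧ (j : ℕ) = 1) ∨ ((i : ℕ) = 1 ∧ (j : ℕ) = 0) then (Real.sinh t : ℝ)
  else if i = j then 1 else 0

/-- The group {B(t) : t ∈ ℝ}, i.e. SO⁰(1,1). -/
def SOo11 (n : ℕ) : Set (Matrix (Fin (n + 1)) (Fin (n + 1)) Quat) :=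
  {M | ∃ t : ℝ, M = Bmat n t}

/-- The group {λ·B(t)} with λ a unit-norm element of span_ℝ{1,i}, i.e. SO⁰(1,1)·U(1). -/
def SOo11U1 (n : ℕ) : Set (Matrix (Fin (n + 1)) (Fin (n + 1)) Quat) :=
  {M | ∃ t : ℝ, ∃ l : Quat, l.imJ = 0 ∧ l.imK = 0 ∧ ‖l‖ = 1 ∧ M = l • Bmat n t}

/-- The group {q·B(t)} with q a unit quaternion, i.e. SO⁰(1,1)·Sp(1). -/
def SOo11Sp1 (n : ℕ) : Set (Matrix (Fin (n + 1)) (Fin (n + 1)) Quat) :=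
  {M | ∃ t : ℝ, ∃ q : Quat, ‖q‖ = 1 ∧ M = q • Bmat n t}

/-- The one-parameter group S_{a,b} = {(cos(bt) + sin(bt)·i)·B(at) : t ∈ ℝ}. -/
def Sab (n : ℕ) (a b : ℝ) : Set (Matrix (Fin (n + 1)) (Fin (n + 1)) Quat) :=
  {M | ∃ t : ℝ, M = (((Real.cos (b * t) : ℝ) : Quat) + ((Real.sin (b * t) : ℝ) : Quat) * qi) • Bmat n (a * t)}

/-- `S` is conjugate in Sp(1,n) to `T`. -/
def ConjInSp (n : ℕ) (S T : Set (Matrix (Fin (n + 1)) (Fin (n + 1)) Quat)) : Prop :=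
  ∃ P ∈ Sp n, ∃ Pinv : Matrix (Fin (n + 1)) (Fin (n + 1)) Quat,
    P * Pinv = 1 ∧ Pinv * P = 1 ∧ (fun A => P * A * Pinv) '' S = T

/-! ### Closed subgroups of the multiplicative group of quaternions -/

/-- A closed subgroup of the multiplicative group of nonzero quaternions, as a set. -/
structure IsQGroup (G : Set Quat) : Prop where
  zero_notMem : (0 : Quat) ∉ G
  one_mem : (1 : Quat) ∈ G
  mul_mem : ∀ x ∈ G, ∀ y ∈ G, x * y ∈ G
  inv_mem : ∀ x ∈ G, x⁻¹ ∈ G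
  closed : ∀ x ∈ closure G, x ≠ 0 → x ∈ G

/-- elements of the Lie algebra -/
def lieSet (G : Set Quat) : Set Quat := {x | ∀ t : ℝ, NormedSpace.exp (t • x) ∈ G}

instance instNAQ : NormedAlgebra ℚ Quat := NormedAlgebra.restrictScalars ℚ ℝ Quat

theorem qexp_ne_zero (x : Quat) : NormedSpace.exp x ≠ 0 := by
  intro h
  have h2 := Quaternion.norm_exp x
  rw [h, norm_zero, ← Real.exp_eq_exp_ℝ] at h2
  have := Real.exp_pos x.re
  rw [Real.norm_of_nonneg this.le] at h2
  linarith

theorem qexp_neg (x : Quat) : NormedSpace.exp (-x) = (NormedSpace.exp x)⁻¹ := by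
  have := NormedSpace.exp_neg x
  exact this

theorem qexp_add {x y : Quat} (h : x * y = y * x) :
    NormedSpace.exp (x + y) = NormedSpace.exp x * NormedSpace.exp y :=
  NormedSpace.exp_add_of_commute h

theorem IsQGroup.zpow_mem {G : Set Quat} (hG : IsQGroup G) {x : Quat} (hx : x ∈ G) (m : ℤ) :
    x ^ m ∈ G := by
  have hp : ∀ k : ℕ, x ^ k ∈ G := by
    intro k
    induction k with
    | zero => simpa using hG.one_mem
    | succ k ih => rw [pow_succ]; exact hG.mul_mem _ ih _ hx
  cases m with
  | ofNat k => simpa using hp k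
  | negSucc k => rw [zpow_negSucc]; exact hG.inv_mem _ (hp _)

open Filter Topology

theorem lie_tangent {G : Set Quat} (hG : IsQGroup G) (x : ℕ → Quat) (r : ℕ → ℝ) (u : Quat)
    (hr0 : ∀ k, 0 < r k) (hr : Tendsto r atTop (𝓝 0))
    (hx : ∀ᶠ k in atTop, NormedSpace.exp (x k) ∈ G)
    (hu : Tendsto (fun k => (r k)⁻¹ • x k) atTop (𝓝 u)) : u ∈ lieSet G := by
  intro t
  refine hG.closed _ ?_ (qexp_ne_zero _)
  have h1 : Tendsto (fun k => (⌊t / r k⌋ : ℝ) * r k) atTop (𝓝 t) := by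
    have hlow : ∀ k, t - r k ≤ (⌊t / r k⌋ : ℝ) * r k := by
      intro k
      have := Int.lt_floor_add_one (t / r k)
      have h2 := mul_lt_mul_of_pos_right this (hr0 k)
      rw [div_mul_cancel₀ _ (hr0 k).ne'] at h2
      linarith
    have hup : ∀ k, (⌊t / r k⌋ : ℝ) * r k ≤ t := by
      intro k
      have := Int.floor_le (t / r k)
      have h2 := mul_le_mul_of_nonneg_right this (hr0 k).le
      rw [div_mul_cancel₀ _ (hr0 k).ne'] at h2
      linarith
    refine tendsto_of_tendsto_of_tendsto_of_le_of_le ?_ tendsto_const_nhds hlow hup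
    simpa using (tendsto_const_nhds (x := t)).sub hr
  have h2 : Tendsto (fun k => ((⌊t / r k⌋ : ℝ) * r k) • ((r k)⁻¹ • x k)) atTop (𝓝 (t • u)) :=
    h1.smul hu
  have h3 : Tendsto (fun k => NormedSpace.exp (((⌊t / r k⌋ : ℝ) * r k) • ((r k)⁻¹ • x k)))
      atTop (𝓝 (NormedSpace.exp (t • u))) :=
    (NormedSpace.exp_continuous.tendsto _).comp h2
  refine mem_closure_of_tendsto h3 ?_
  filter_upwards [hx] with k hk
  have : ((⌊t / r k⌋ : ℝ) * r k) • ((r k)⁻¹ • x k) = ⌊t / r k⌋ • x k := by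
    rw [smul_smul, mul_assoc, mul_inv_cancel₀ (hr0 k).ne', mul_one, Int.cast_smul_eq_zsmul]
  rw [this, NormedSpace.exp_zsmul]
  exact hG.zpow_mem hk _

theorem lieq_add {G : Set Quat} (hG : IsQGroup G) {x y : Quat} (hx : x ∈ lieSet G)
    (hy : y ∈ lieSet G) : x + y ∈ lieSet G := by
  have hE : HasStrictFDerivAt (NormedSpace.exp : Quat → Quat)
      ((ContinuousLinearEquiv.refl ℝ Quat : Quat ≃L[ℝ] Quat) : Quat →L[ℝ] Quat) 0 :=
    hasStrictFDerivAt_exp_zero (𝕂 := ℝ)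
  set L := HasStrictFDerivAt.localInverse _ _ _ hE with hL
  have hLd := hE.to_localInverse
  have hLr := hE.eventually_right_inverse
  have hL0 := hE.localInverse_apply_image
  rw [← hL] at hLd hLr hL0
  rw [NormedSpace.exp_zero] at hLd hLr hL0
  have hc : HasDerivAt (fun s : ℝ => NormedSpace.exp (s • x) * NormedSpace.exp (s • y)) (x + y) 0 := by
    have h1 := hasDerivAt_exp_smul_const (𝕂 := ℝ) x 0
    have h2 := hasDerivAt_exp_smul_const (𝕂 := ℝ) y 0
    have := h1.mul h2
    refine HasDerivAt.congr_deriv this ?_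
    simp [NormedSpace.exp_zero]
  have hc0 : NormedSpace.exp ((0 : ℝ) • x) * NormedSpace.exp ((0 : ℝ) • y) = 1 := by
    simp [NormedSpace.exp_zero]
  have hd : HasDerivAt (fun s : ℝ => L (NormedSpace.exp (s • x) * NormedSpace.exp (s • y)))
      (x + y) 0 := by
    have := HasFDerivAt.comp_hasDerivAt (x := (0 : ℝ))
      (f := fun s : ℝ => NormedSpace.exp (s • x) * NormedSpace.exp (s • y)) (l := L)
      (l' := ((ContinuousLinearEquiv.refl ℝ Quat).symm : Quat →L[ℝ] Quat)) (f' := x + y)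
      (by rw [hc0]; exact hLd.hasFDerivAt) hc
    exact this
  have hr : Tendsto (fun k : ℕ => 1 / ((k : ℝ) + 1)) atTop (𝓝 0) :=
    tendsto_one_div_add_atTop_nhds_zero_nat
  have hrp : ∀ k : ℕ, (0 : ℝ) < 1 / ((k : ℝ) + 1) := fun k => by positivity
  refine lie_tangent hG (fun k : ℕ => L (NormedSpace.exp ((1 / ((k : ℝ) + 1)) • x) *
    NormedSpace.exp ((1 / ((k : ℝ) + 1)) • y))) (fun k => 1 / ((k : ℝ) + 1)) _ hrp hr ?_ ?_
  · have h1 : Tendsto (fun k : ℕ => NormedSpace.exp ((1 / ((k : ℝ) + 1)) • x) *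
        NormedSpace.exp ((1 / ((k : ℝ) + 1)) • y)) atTop (𝓝 1) := by
      have := hc.continuousAt.tendsto.comp hr
      rw [hc0] at this
      exact this
    filter_upwards [h1.eventually hLr] with k hk
    rw [hk]
    exact hG.mul_mem _ (hx _) _ (hy _)
  · have h1 := hd.tendsto_slope_zero
    have h2 : Tendsto (fun k : ℕ => 1 / ((k : ℝ) + 1)) atTop (𝓝[≠] 0) :=
      tendsto_nhdsWithin_iff.2 ⟨hr, Eventually.of_forall fun k => (hrp k).ne'⟩
    have h3 := h1.comp h2
    simpa [Function.comp_def, NormedSpace.exp_zero, hL0] using h3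

/-- Lie algebra as a real subspace. -/
def lieAlg {G : Set Quat} (hG : IsQGroup G) : Submodule ℝ Quat where
  carrier := lieSet G
  add_mem' := lieq_add hG
  zero_mem' := fun t => by simpa [NormedSpace.exp_zero] using hG.one_mem
  smul_mem' := fun c x hx t => by rw [smul_smul]; exact hx _

theorem mem_lieAlg {G : Set Quat} (hG : IsQGroup G) {x : Quat} :
    x ∈ lieAlg hG ↔ ∀ t : ℝ, NormedSpace.exp (t • x) ∈ G := Iff.rfl

theorem lieAlg_exp {G : Set Quat} (hG : IsQGroup G) {x : Quat} (hx : x ∈ lieAlg hG) :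
    NormedSpace.exp x ∈ G := by simpa using hx 1

theorem lie_compl {G : Set Quat} (hG : IsQGroup G) (m : Submodule ℝ Quat)
    (hm : Disjoint (lieAlg hG) m) :
    ∃ δ > 0, ∀ y ∈ m, ‖y‖ < δ → NormedSpace.exp y ∈ G → y = 0 := by
  by_contra hcon
  push Not at hcon
  choose y hym hyd hyG hy0 using fun k : ℕ => hcon (1 / ((k : ℝ) + 1)) (by positivity)
  have hn0 : ∀ k, 0 < ‖y k‖ := fun k => norm_pos_iff.2 (hy0 k)
  have hr : Tendsto (fun k => ‖y k‖) atTop (𝓝 0) :=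
    squeeze_zero (fun k => norm_nonneg _) (fun k => (hyd k).le)
      tendsto_one_div_add_atTop_nhds_zero_nat
  have hs : ∀ k, ‖y k‖⁻¹ • y k ∈ Metric.sphere (0 : Quat) 1 := by
    intro k
    simp [norm_smul, (hn0 k).ne']
  obtain ⟨u, hu, φ, hφ, hlim⟩ := (isCompact_sphere (0 : Quat) 1).tendsto_subseq hs
  have h1 : u ∈ lieSet G :=
    lie_tangent hG (fun k => y (φ k)) (fun k => ‖y (φ k)‖) u (fun k => hn0 _)
      (hr.comp hφ.tendsto_atTop) (Eventually.of_forall fun k => hyG _) hlim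
  have h2 : u ∈ m := by
    have hcl : IsClosed (m : Set Quat) := m.closed_of_finiteDimensional
    exact hcl.mem_of_tendsto hlim (Eventually.of_forall fun k => m.smul_mem _ (hym _))
  have h3 : u = 0 := by
    have := Submodule.disjoint_def.1 hm u h1 h2
    exact this
  rw [h3] at hu
  simp at hu

theorem lie_nhds {G : Set Quat} (hG : IsQGroup G) :
    ∀ᶠ g in 𝓝 (1 : Quat), g ∈ G → ∃ x ∈ lieAlg hG, g = NormedSpace.exp x := by
  obtain ⟨m, hm⟩ := Submodule.exists_isCompl (lieAlg hG)
  obtain ⟨δ, hδ, hδm⟩ := lie_compl hG m hm.disjoint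
  have hE : HasStrictFDerivAt (NormedSpace.exp : Quat → Quat) (1 : Quat →L[ℝ] Quat) 0 :=
    hasStrictFDerivAt_exp_zero (𝕂 := ℝ)
  let F : (lieAlg hG × m) → Quat := fun p =>
    NormedSpace.exp (p.1 : Quat) * NormedSpace.exp (p.2 : Quat)
  let f1 : (lieAlg hG × m) →L[ℝ] Quat := (lieAlg hG).subtypeL.comp (ContinuousLinearMap.fst ℝ _ _)
  let f2 : (lieAlg hG × m) →L[ℝ] Quat := m.subtypeL.comp (ContinuousLinearMap.snd ℝ _ _)
  have hF : HasStrictFDerivAt F (f1 + f2) 0 := by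
    have h1 : HasStrictFDerivAt (fun p : lieAlg hG × m => NormedSpace.exp (p.1 : Quat)) f1 0 := by
      have := HasStrictFDerivAt.comp (x := (0 : lieAlg hG × m)) (f := f1) (f' := f1)
        (g := NormedSpace.exp) (g' := (1 : Quat →L[ℝ] Quat))
        (by simpa using hE) f1.hasStrictFDerivAt
      exact this
    have h2 : HasStrictFDerivAt (fun p : lieAlg hG × m => NormedSpace.exp (p.2 : Quat)) f2 0 := by
      have := HasStrictFDerivAt.comp (x := (0 : lieAlg hG × m)) (f := f2) (f' := f2)
        (g := NormedSpace.exp) (g' := (1 : Quat →L[ℝ] Quat))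
        (by simpa using hE) f2.hasStrictFDerivAt
      exact this
    have h3 := h1.mul' h2
    refine HasStrictFDerivAt.congr_fderiv h3 ?_
    refine ContinuousLinearMap.ext fun p => ?_
    simp [NormedSpace.exp_zero, f1, f2, add_comm]
  have hsurj : (f1 + f2).range = ⊤ := by
    rw [LinearMap.range_eq_top]
    intro z
    have hz : z ∈ lieAlg hG ⊔ m := by rw [hm.sup_eq_top]; trivial
    obtain ⟨a, ha, b, hb, hab⟩ := Submodule.mem_sup.1 hz
    exact ⟨(⟨a, ha⟩, ⟨b, hb⟩), by simpa [f1, f2] using hab⟩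
  have hmap := hF.map_nhds_eq_of_surj hsurj
  have hF0 : F 0 = 1 := by simp [F, NormedSpace.exp_zero]
  rw [hF0] at hmap
  have hU : {p : lieAlg hG × m | ‖(p.2 : Quat)‖ < δ} ∈ 𝓝 (0 : lieAlg hG × m) := by
    apply IsOpen.mem_nhds
    · exact isOpen_lt (by fun_prop) continuous_const
    · simpa using hδ
  have := image_mem_map (m := F) hU
  rw [hmap] at this
  filter_upwards [this] with g hg hgG
  obtain ⟨⟨⟨a, ha⟩, ⟨b, hb⟩⟩, hp, rfl⟩ := hg
  have hbG : NormedSpace.exp b ∈ G := by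
    have h1 := hG.mul_mem _ (hG.inv_mem _ (lieAlg_exp hG ha)) _ hgG
    simp only [F] at h1
    rwa [inv_mul_cancel_left₀ (qexp_ne_zero a)] at h1
  have hb0 := hδm b hb hp hbG
  exact ⟨a, ha, by simp [F, hb0, NormedSpace.exp_zero]⟩

theorem lie_generate {G : Set Quat} (hG : IsQGroup G) (hconn : IsPreconnected G)
    (S : Set Quat) (h1 : (1 : Quat) ∈ S) (hmul : ∀ x ∈ S, ∀ y ∈ S, x * y ∈ S)
    (hinv : ∀ x ∈ S, x⁻¹ ∈ S) (hS : ∀ x ∈ lieAlg hG, NormedSpace.exp x ∈ S) : G ⊆ S := by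
  have key : ∀ g ∈ G, ∀ᶠ y in 𝓝 g, y ∈ G → g⁻¹ * y ∈ S := by
    intro g hg
    have hg0 : g ≠ 0 := fun h => hG.zero_notMem (h ▸ hg)
    have ht : Tendsto (fun y : Quat => g⁻¹ * y) (𝓝 g) (𝓝 1) := by
      have : Continuous (fun y : Quat => g⁻¹ * y) := by fun_prop
      have := this.tendsto g
      rwa [inv_mul_cancel₀ hg0] at this
    filter_upwards [ht.eventually (lie_nhds hG)] with y hy hyG
    obtain ⟨x, hx, hxe⟩ := hy (hG.mul_mem _ (hG.inv_mem _ hg) _ hyG)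
    rw [hxe]
    exact hS x hx
  by_contra hcon
  obtain ⟨b, hbG, hbS⟩ := Set.not_subset.1 hcon
  have hu : ∀ g ∈ G, g ∈ S → ∀ᶠ y in 𝓝 g, y ∈ G → y ∈ S := by
    intro g hg hgS
    have hg0 : g ≠ 0 := fun h => hG.zero_notMem (h ▸ hg)
    filter_upwards [key g hg] with y hy hyG
    have := hmul _ hgS _ (hy hyG)
    rwa [mul_inv_cancel_left₀ hg0] at this
  have hv : ∀ g ∈ G, g ∉ S → ∀ᶠ y in 𝓝 g, y ∈ G → y ∉ S := by
    intro g hg hgS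
    have hg0 : g ≠ 0 := fun h => hG.zero_notMem (h ▸ hg)
    filter_upwards [key g hg] with y hy hyG hyS
    have hy0 : y ≠ 0 := fun h => hG.zero_notMem (h ▸ hyG)
    have := hmul _ hyS _ (hinv _ (hy hyG))
    rw [_root_.mul_inv_rev, inv_inv, mul_inv_cancel_left₀ hy0] at this
    exact hgS this
  have := hconn (interior {y | y ∈ G → y ∈ S}) (interior {y | y ∈ G → y ∉ S})
    isOpen_interior isOpen_interior ?_ ⟨1, hG.one_mem, mem_interior_iff_mem_nhds.2 (hu 1 hG.one_mem h1)⟩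
    ⟨b, hbG, mem_interior_iff_mem_nhds.2 (hv b hbG hbS)⟩
  · obtain ⟨z, hz, hz1, hz2⟩ := this
    exact interior_subset hz2 hz (interior_subset hz1 hz)
  · intro g hg
    by_cases hgS : g ∈ S
    · exact Or.inl (mem_interior_iff_mem_nhds.2 (hu g hg hgS))
    · exact Or.inr (mem_interior_iff_mem_nhds.2 (hv g hg hgS))

theorem lie_Ad {G : Set Quat} (hG : IsQGroup G) {x g : Quat} (hx : x ∈ lieAlg hG) (hg : g ∈ G) :
    g * x * g⁻¹ ∈ lieAlg hG := by
  intro t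
  have hg0 : g ≠ 0 := fun h => hG.zero_notMem (h ▸ hg)
  have : t • (g * x * g⁻¹) = g * (t • x) * g⁻¹ := by
    rw [mul_smul_comm, smul_mul_assoc]
  rw [this, NormedSpace.exp_conj _ _ hg0]
  exact hG.mul_mem _ (hG.mul_mem _ hg _ (hx t)) _ (hG.inv_mem _ hg)

theorem lie_bracket {G : Set Quat} (hG : IsQGroup G) {x y : Quat} (hx : x ∈ lieAlg hG)
    (hy : y ∈ lieAlg hG) : x * y - y * x ∈ lieAlg hG := by
  have hcl : IsClosed (lieAlg hG : Set Quat) := (lieAlg hG).closed_of_finiteDimensional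
  have hd : HasDerivAt (fun s : ℝ => NormedSpace.exp (s • x) * y * NormedSpace.exp (s • (-x)))
      (x * y - y * x) 0 := by
    have h1 := hasDerivAt_exp_smul_const (𝕂 := ℝ) x 0
    have h2 := hasDerivAt_exp_smul_const (𝕂 := ℝ) (-x) 0
    have := (h1.mul_const y).mul h2
    refine HasDerivAt.congr_deriv this ?_
    simp [NormedSpace.exp_zero, sub_eq_add_neg]
  refine hcl.mem_of_tendsto hd.tendsto_slope_zero (Eventually.of_forall fun s => ?_)
  refine (lieAlg hG).smul_mem _ ((lieAlg hG).sub_mem ?_ ?_)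
  · rw [smul_neg, qexp_neg]
    exact lie_Ad hG hy (hx _)
  · simpa [NormedSpace.exp_zero] using hy

/-- a quaternion from its coordinates -/
def mk4 (a b c d : ℝ) : Quat := ⟨a, b, c, d⟩
@[simp] theorem mk4_re (a b c d : ℝ) : (mk4 a b c d).re = a := rfl
@[simp] theorem mk4_imI (a b c d : ℝ) : (mk4 a b c d).imI = b := rfl
@[simp] theorem mk4_imJ (a b c d : ℝ) : (mk4 a b c d).imJ = c := rfl
@[simp] theorem mk4_imK (a b c d : ℝ) : (mk4 a b c d).imK = d := rfl

theorem q_norm_sq (q : Quat) : ‖q‖ ^ 2 = q.re ^ 2 + q.imI ^ 2 + q.imJ ^ 2 + q.imK ^ 2 := by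
  rw [← Quaternion.normSq_def', Quaternion.normSq_eq_norm_mul_self, sq]

theorem q_norm_one_iff (q : Quat) :
    ‖q‖ = 1 ↔ q.re ^ 2 + q.imI ^ 2 + q.imJ ^ 2 + q.imK ^ 2 = 1 := by
  rw [← q_norm_sq]
  constructor
  · intro h; rw [h]; norm_num
  · intro h
    have := norm_nonneg q
    nlinarith

theorem q_mul_star (u : Quat) (hu : ‖u‖ = 1) : u * star u = 1 := by
  rw [Quaternion.self_mul_star, Quaternion.normSq_eq_norm_mul_self, hu]; simp

theorem q_star_mul (u : Quat) (hu : ‖u‖ = 1) : star u * u = 1 := by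
  rw [Quaternion.star_mul_self, Quaternion.normSq_eq_norm_mul_self, hu]; simp

theorem q_conj_complex (x : Quat) :
    ∃ u : Quat, ‖u‖ = 1 ∧ (u * x * star u).imJ = 0 ∧ (u * x * star u).imK = 0 := by
  by_cases h : x.imJ = 0 ∧ x.imK = 0
  · exact ⟨1, by simp, by simp [h.1], by simp [h.2]⟩
  · set r : ℝ := ‖x.im‖ with hr
    have hr2 : r ^ 2 = x.imI ^ 2 + x.imJ ^ 2 + x.imK ^ 2 := by
      rw [hr, q_norm_sq]; simp
    let w : Quat := mk4 0 (r + x.imI) x.imJ x.imK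
    have hw0 : w ≠ 0 := by
      intro hw
      apply h
      exact ⟨congrArg (fun q : Quat => q.imJ) hw, congrArg (fun q : Quat => q.imK) hw⟩
    have hn : ‖w‖ ≠ 0 := norm_ne_zero_iff.2 hw0
    refine ⟨‖w‖⁻¹ • w, ?_, ?_, ?_⟩
    · rw [norm_smul, norm_inv, norm_norm, inv_mul_cancel₀ hn]
    · have : (‖w‖⁻¹ • w * x * star (‖w‖⁻¹ • w)).imJ = ‖w‖⁻¹ * ‖w‖⁻¹ * (w * x * star w).imJ := by
        simp [Quaternion.imJ_mul, Quaternion.re_mul, Quaternion.imI_mul, Quaternion.imK_mul]; ring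
      rw [this]
      have : (w * x * star w).imJ = 0 := by
        simp [w, Quaternion.imJ_mul, Quaternion.re_mul, Quaternion.imI_mul, Quaternion.imK_mul]
        linear_combination (-x.imJ) * hr2
      rw [this, mul_zero]
    · have : (‖w‖⁻¹ • w * x * star (‖w‖⁻¹ • w)).imK = ‖w‖⁻¹ * ‖w‖⁻¹ * (w * x * star w).imK := by
        simp [Quaternion.imJ_mul, Quaternion.re_mul, Quaternion.imI_mul, Quaternion.imK_mul]; ring
      rw [this]
      have : (w * x * star w).imK = 0 := by
        simp [w, Quaternion.imJ_mul, Quaternion.re_mul, Quaternion.imI_mul, Quaternion.imK_mul]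
        linear_combination (-x.imK) * hr2
      rw [this, mul_zero]

theorem qexp_complex (a b : ℝ) :
    NormedSpace.exp (mk4 (a) (b) (0) (0)) = Real.exp a • (mk4 (Real.cos b) (Real.sin b) (0) (0)) := by
  rw [Quaternion.exp_eq, ← Real.exp_eq_exp_ℝ]
  have hn : ‖(mk4 (a) (b) (0) (0)).im‖ = |b| := by
    have h := q_norm_sq (mk4 (a) (b) (0) (0)).im
    simp at h
    rw [← abs_norm]
    exact (sq_eq_sq_iff_abs_eq_abs _ _).1 h
  rw [hn]
  congr 1
  ext
  · simp
  · simp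
    rcases abs_cases b with ⟨h, h'⟩ | ⟨h, h'⟩
    · rw [h]
      by_cases hb : b = 0
      · simp [hb]
      · field_simp
    · rw [h, Real.sin_neg]
      have : b ≠ 0 := h'.ne
      field_simp
  · simp
  · simp

theorem unit_complex (l : Quat) (hJ : l.imJ = 0) (hK : l.imK = 0) (hl : ‖l‖ = 1) :
    ∃ θ : ℝ, l = mk4 (Real.cos θ) (Real.sin θ) 0 0 := by
  rw [q_norm_one_iff, hJ, hK] at hl
  let z : ℂ := ⟨l.re, l.imI⟩
  have hz : ‖z‖ = 1 := by
    have : ‖z‖ ^ 2 = 1 := by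
      rw [Complex.sq_norm, Complex.normSq_apply]; simp only [z]; linarith
    have := norm_nonneg z
    nlinarith
  refine ⟨z.arg, ?_⟩
  have h1 := Complex.norm_mul_cos_arg z
  have h2 := Complex.norm_mul_sin_arg z
  rw [hz, one_mul] at h1 h2
  ext
  · exact h1.symm
  · exact h2.symm
  · exact hJ
  · exact hK

/-- unit complex -/
def setU : Set Quat := {l | l.imJ = 0 ∧ l.imK = 0 ∧ ‖l‖ = 1}
/-- unit quaternions -/
def setS : Set Quat := {q | ‖q‖ = 1}
/-- positive reals -/
def setR : Set Quat := {q | ∃ t : ℝ, q = Real.exp t • (1 : Quat)}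
/-- nonzero complex numbers -/
def setRU : Set Quat := {q | ∃ t : ℝ, ∃ l ∈ setU, q = Real.exp t • l}
/-- nonzero quaternions -/
def setRS : Set Quat := {q | ∃ t : ℝ, ∃ l ∈ setS, q = Real.exp t • l}
/-- spirals -/
def setSp (a b : ℝ) : Set Quat :=
  {q | ∃ t : ℝ, q = Real.exp (a * t) • (mk4 (Real.cos (b * t)) (Real.sin (b * t)) (0) (0))}

theorem norm_cis (b : ℝ) : ‖(mk4 (Real.cos b) (Real.sin b) (0) (0))‖ = 1 := by
  rw [q_norm_one_iff]; simp

theorem classify_comm {G : Set Quat} (hG : IsQGroup G) (hconn : IsPreconnected G)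
    (hc : ∀ x ∈ lieAlg hG, x.imJ = 0 ∧ x.imK = 0) :
    G = {1} ∨ G = setU ∨ G = setR ∨ G = setRU ∨ ∃ a b : ℝ, a ≠ 0 ∧ b ≠ 0 ∧ G = setSp a b := by
  have hform : ∀ x ∈ lieAlg hG, x = (mk4 (x.re) (x.imI) (0) (0)) := by
    intro x hx
    ext <;> simp [hc x hx]
  have hGe : ∀ g, g ∈ G ↔ ∃ x ∈ lieAlg hG, g = NormedSpace.exp x := by
    intro g
    constructor
    · intro hg
      refine lie_generate hG hconn {g | ∃ x ∈ lieAlg hG, g = NormedSpace.exp x} ?_ ?_ ?_ ?_ hg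
      · exact ⟨0, (lieAlg hG).zero_mem, by rw [NormedSpace.exp_zero]⟩
      · rintro _ ⟨x, hx, rfl⟩ _ ⟨y, hy, rfl⟩
        refine ⟨x + y, (lieAlg hG).add_mem hx hy, (qexp_add ?_).symm⟩
        rw [hform x hx, hform y hy]
        ext <;> simp [Quaternion.imJ_mul, Quaternion.re_mul, Quaternion.imI_mul, Quaternion.imK_mul] <;> ring
      · rintro _ ⟨x, hx, rfl⟩
        exact ⟨-x, (lieAlg hG).neg_mem hx, (qexp_neg x).symm⟩
      · intro x hx
        exact ⟨x, hx, rfl⟩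
    · rintro ⟨x, hx, rfl⟩
      exact lieAlg_exp hG hx
  by_cases h0 : ∀ x ∈ lieAlg hG, x = 0
  · left
    ext g
    rw [hGe, Set.mem_singleton_iff]
    constructor
    · rintro ⟨x, hx, rfl⟩
      rw [h0 x hx, NormedSpace.exp_zero]
    · rintro rfl
      exact ⟨0, (lieAlg hG).zero_mem, by rw [NormedSpace.exp_zero]⟩
  right
  push Not at h0
  obtain ⟨x, hx, hx0⟩ := h0
  set a := x.re with ha
  set b := x.imI with hb
  have hxf : x = mk4 a b 0 0 := hform x hx
  by_cases h2 : ∃ y ∈ lieAlg hG, a * y.imI - b * y.re ≠ 0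
  · right; right; left
    obtain ⟨y, hy, hD⟩ := h2
    have hall : ∀ c d : ℝ, (mk4 (c) (d) (0) (0)) ∈ lieAlg hG := by
      intro c d
      have : (mk4 (c) (d) (0) (0)) = ((c * y.imI - d * y.re) / (a * y.imI - b * y.re)) • x +
          ((a * d - b * c) / (a * y.imI - b * y.re)) • y := by
        rw [hxf]
        obtain ⟨D, hDe⟩ : ∃ D, D = a * y.imI - b * y.re := ⟨_, rfl⟩
        rw [← hDe] at hD ⊢
        ext
        · simp; field_simp; rw [hDe]; ring
        · simp; field_simp; rw [hDe]; ring
        · simp [(hc y hy).1]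
        · simp [(hc y hy).2]
      rw [this]
      exact (lieAlg hG).add_mem ((lieAlg hG).smul_mem _ hx) ((lieAlg hG).smul_mem _ hy)
    ext g
    rw [hGe]
    constructor
    · rintro ⟨z, hz, rfl⟩
      rw [hform z hz, qexp_complex]
      exact ⟨_, _, ⟨rfl, rfl, norm_cis _⟩, rfl⟩
    · rintro ⟨t, l, ⟨hJ, hK, hl⟩, rfl⟩
      obtain ⟨θ, rfl⟩ := unit_complex l hJ hK hl
      exact ⟨mk4 t θ 0 0, hall _ _, (qexp_complex _ _).symm⟩
  push Not at h2
  have hab : a ^ 2 + b ^ 2 ≠ 0 := by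
    intro h
    apply hx0
    have h1 : a = 0 := by nlinarith [sq_nonneg a, sq_nonneg b]
    have h2 : b = 0 := by nlinarith [sq_nonneg a, sq_nonneg b]
    rw [hxf, h1, h2]; rfl
  have hG2 : ∀ g, g ∈ G ↔ ∃ t : ℝ, g = Real.exp (a * t) •
      (mk4 (Real.cos (b * t)) (Real.sin (b * t)) (0) (0)) := by
    intro g
    rw [hGe]
    constructor
    · rintro ⟨y, hy, rfl⟩
      refine ⟨(a * y.re + b * y.imI) / (a ^ 2 + b ^ 2), ?_⟩
      have hD := h2 y hy
      rw [← qexp_complex]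
      congr 1
      ext
      · simp; field_simp; linear_combination (-b) * hD
      · simp; field_simp; linear_combination a * hD
      · simp [(hc y hy).1]
      · simp [(hc y hy).2]
    · rintro ⟨t, rfl⟩
      refine ⟨t • x, (lieAlg hG).smul_mem _ hx, ?_⟩
      rw [← qexp_complex, hxf]
      congr 1
      ext <;> simp [mul_comm]
  by_cases ha0 : a = 0
  · left
    have hb0 : b ≠ 0 := by rintro h; apply hab; rw [ha0, h]; norm_num
    ext g
    rw [hG2]
    constructor
    · rintro ⟨t, rfl⟩
      rw [ha0, zero_mul, Real.exp_zero, one_smul]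
      exact ⟨rfl, rfl, norm_cis _⟩
    · rintro ⟨hJ, hK, hl⟩
      obtain ⟨θ, rfl⟩ := unit_complex g hJ hK hl
      refine ⟨θ / b, ?_⟩
      rw [ha0, zero_mul, Real.exp_zero, one_smul, mul_div_cancel₀ _ hb0]
  by_cases hb0 : b = 0
  · right; left
    have h1 : (mk4 (1) (0) (0) (0)) = 1 := rfl
    ext g
    rw [hG2]
    constructor
    · rintro ⟨t, rfl⟩
      rw [hb0, zero_mul, Real.cos_zero, Real.sin_zero, h1]
      exact ⟨_, rfl⟩
    · rintro ⟨t, rfl⟩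
      refine ⟨t / a, ?_⟩
      rw [hb0, zero_mul, Real.cos_zero, Real.sin_zero, h1, mul_div_cancel₀ _ ha0]
  · right; right; right
    refine ⟨a, b, ha0, hb0, ?_⟩
    ext g
    exact hG2 g

theorem unit_exp (q : Quat) (hq : ‖q‖ = 1) : ∃ m : Quat, m.re = 0 ∧ q = NormedSpace.exp m := by
  obtain ⟨u, hu, hJ, hK⟩ := q_conj_complex q
  have hs := q_star_mul u hu
  have hs' := q_mul_star u hu
  have hu0 : star u ≠ 0 := by intro h; rw [h, zero_mul] at hs; exact zero_ne_one hs
  have hinv : (star u)⁻¹ = u := by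
    rw [inv_eq_iff_eq_inv]; exact eq_inv_of_mul_eq_one_left hs
  have hn : ‖u * q * star u‖ = 1 := by rw [norm_mul, norm_mul, norm_star, hu, hq]; norm_num
  obtain ⟨θ, hθ⟩ := unit_complex _ hJ hK hn
  refine ⟨star u * mk4 0 θ 0 0 * u, ?_, ?_⟩
  · simp [Quaternion.imJ_mul, Quaternion.re_mul, Quaternion.imI_mul, Quaternion.imK_mul]; ring
  · have h1 := NormedSpace.exp_conj (star u) (mk4 (0) (θ) (0) (0)) hu0
    rw [hinv, qexp_complex, Real.exp_zero, one_smul, ← hθ] at h1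
    rw [h1]
    calc q = (star u * u) * q * (star u * u) := by rw [hs]; simp
      _ = _ := by simp only [mul_assoc]

theorem classify_nc {G : Set Quat} (hG : IsQGroup G) (hconn : IsPreconnected G)
    (x y : Quat) (hx : x ∈ lieAlg hG) (hy : y ∈ lieAlg hG) (hxy : x * y ≠ y * x) :
    G = setS ∨ G = setRS := by
  have hz := lie_bracket hG hx hy
  have hzx := lie_bracket hG hz hx
  have hzy := lie_bracket hG hz hy
  set z := x * y - y * x with hzdef
  have hzI : z.imI = 2 * (x.imJ * y.imK - x.imK * y.imJ) := by
    simp [hzdef, Quaternion.imI_mul]; ring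
  have hzJ : z.imJ = 2 * (x.imK * y.imI - x.imI * y.imK) := by
    simp [hzdef, Quaternion.imJ_mul]; ring
  have hzK : z.imK = 2 * (x.imI * y.imJ - x.imJ * y.imI) := by
    simp [hzdef, Quaternion.imK_mul]; ring
  have hzR : z.re = 0 := by
    simp [hzdef, Quaternion.re_mul]; ring
  set N : ℝ := z.imI ^ 2 + z.imJ ^ 2 + z.imK ^ 2 with hN
  have hN0 : N ≠ 0 := by
    intro h
    apply hxy
    rw [← sub_eq_zero, ← hzdef]
    ext
    · exact hzR
    · show z.imI = 0
      nlinarith [sq_nonneg z.imI, sq_nonneg z.imJ, sq_nonneg z.imK]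
    · show z.imJ = 0
      nlinarith [sq_nonneg z.imI, sq_nonneg z.imJ, sq_nonneg z.imK]
    · show z.imK = 0
      nlinarith [sq_nonneg z.imI, sq_nonneg z.imJ, sq_nonneg z.imK]
  have hwmem : ∀ w : Quat, w.re = 0 → w ∈ lieAlg hG := by
    intro w hw
    have : w = N⁻¹ • ((w.imI * z.imI + w.imJ * z.imJ + w.imK * z.imK) • z +
        (w.imI * y.imI + w.imJ * y.imJ + w.imK * y.imK) • (z * x - x * z) -
        (w.imI * x.imI + w.imJ * x.imJ + w.imK * x.imK) • (z * y - y * z)) := by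
      rw [eq_inv_smul_iff₀ hN0, hN]
      ext
      · simp [Quaternion.re_mul, hw, hzR]; ring
      · simp [Quaternion.imI_mul, hzR, hzI, hzJ, hzK]; ring
      · simp [Quaternion.imJ_mul, hzR, hzI, hzJ, hzK]; ring
      · simp [Quaternion.imK_mul, hzR, hzI, hzJ, hzK]; ring
    rw [this]
    exact (lieAlg hG).smul_mem _ ((lieAlg hG).sub_mem ((lieAlg hG).add_mem
      ((lieAlg hG).smul_mem _ hz) ((lieAlg hG).smul_mem _ hzx)) ((lieAlg hG).smul_mem _ hzy))
  have hSG : setS ⊆ G := by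
    intro q hq
    obtain ⟨m, hm, rfl⟩ := unit_exp q hq
    exact lieAlg_exp hG (hwmem m hm)
  by_cases hre : ∀ w ∈ lieAlg hG, w.re = 0
  · left
    refine Set.Subset.antisymm ?_ hSG
    refine lie_generate hG hconn setS (by simp [setS]) ?_ ?_ ?_
    · intro p hp q hq
      simp only [setS, Set.mem_ofPred_eq] at *
      rw [norm_mul, hp, hq, one_mul]
    · intro p hp
      simp only [setS, Set.mem_ofPred_eq] at *
      rw [norm_inv, hp, inv_one]
    · intro w hw
      simp only [setS, Set.mem_ofPred_eq]
      rw [Quaternion.norm_exp, hre w hw]; simp [NormedSpace.exp_zero]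
  · right
    push Not at hre
    obtain ⟨w, hw, hw0⟩ := hre
    have h1 : (1 : Quat) ∈ lieAlg hG := by
      have : (1 : Quat) = w.re⁻¹ • (w - w.im) := by
        rw [eq_inv_smul_iff₀ hw0]
        ext <;> simp
      rw [this]
      exact (lieAlg hG).smul_mem _ ((lieAlg hG).sub_mem hw (hwmem _ (by simp)))
    have hreal : ∀ t : ℝ, Real.exp t • (1 : Quat) ∈ G := by
      intro t
      have h2 := h1 t
      have h3 : t • (1 : Quat) = mk4 t 0 0 0 := by ext <;> simp
      rw [h3, qexp_complex] at h2
      convert h2 using 2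
      ext <;> simp
    ext g
    constructor
    · intro hg
      have hg0 : g ≠ 0 := fun h => hG.zero_notMem (h ▸ hg)
      have hn : 0 < ‖g‖ := norm_pos_iff.2 hg0
      refine ⟨Real.log ‖g‖, ‖g‖⁻¹ • g, ?_, ?_⟩
      · simp [setS, norm_smul, hn.ne']
      · rw [Real.exp_log hn, smul_smul, mul_inv_cancel₀ hn.ne', one_smul]
    · rintro ⟨t, q, hq, rfl⟩
      have := hG.mul_mem _ (hreal t) _ (hSG hq)
      simpa using this

theorem IsQGroup.conj {G : Set Quat} (hG : IsQGroup G) (u : Quat) (hu : ‖u‖ = 1) :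
    IsQGroup {y | star u * y * u ∈ G} := by
  have h1 := q_star_mul u hu
  have h2 := q_mul_star u hu
  refine ⟨?_, ?_, ?_, ?_, ?_⟩
  · simpa using hG.zero_notMem
  · simpa [h1] using hG.one_mem
  · intro x hx y hy
    have := hG.mul_mem _ hx _ hy
    show star u * (x * y) * u ∈ G
    convert this using 1
    calc star u * (x * y) * u = star u * x * 1 * y * u := by simp only [mul_assoc, one_mul]
      _ = _ := by rw [← h2]; simp only [mul_assoc]
  · intro x hx
    have := hG.inv_mem _ hx
    show star u * x⁻¹ * u ∈ G
    convert this using 1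
    have hi : u⁻¹ = star u := (eq_inv_of_mul_eq_one_left h1).symm
    have hi' : (star u)⁻¹ = u := by rw [← hi, inv_inv]
    rw [_root_.mul_inv_rev, _root_.mul_inv_rev, hi, hi', mul_assoc]
  · intro x hx hx0
    apply hG.closed
    · have hcont : Continuous (fun y : Quat => star u * y * u) := by fun_prop
      have := hcont.closure_preimage_subset G
      exact this hx
    · intro h
      apply hx0
      calc x = (u * star u) * x * (u * star u) := by rw [h2]; simp
        _ = u * (star u * x * u) * star u := by simp only [mul_assoc]
        _ = 0 := by rw [h]; simp

theorem classify {G : Set Quat} (hG : IsQGroup G) (hconn : IsPreconnected G) :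
    ∃ u : Quat, ‖u‖ = 1 ∧ ∃ T : Set Quat, T = (fun g => u * g * star u) '' G ∧
      (T = {1} ∨ T = setU ∨ T = setS ∨ T = setR ∨ T = setRU ∨ T = setRS ∨
        ∃ a b : ℝ, a ≠ 0 ∧ b ≠ 0 ∧ T = setSp a b) := by
  by_cases hcm : ∀ x ∈ lieAlg hG, ∀ y ∈ lieAlg hG, x * y = y * x
  · obtain ⟨x, hx, hxn⟩ : ∃ x ∈ lieAlg hG, (x.im = 0 → ∀ y ∈ lieAlg hG, y.im = 0) := by
      by_cases h : ∀ y ∈ lieAlg hG, y.im = 0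
      · exact ⟨0, (lieAlg hG).zero_mem, fun _ => h⟩
      · push Not at h
        obtain ⟨y, hy, hy0⟩ := h
        exact ⟨y, hy, fun h => absurd h hy0⟩
    obtain ⟨u, hu, hJ, hK⟩ := q_conj_complex x
    have h1 := q_star_mul u hu
    have h2 := q_mul_star u hu
    have hG' := hG.conj u hu
    have himg : {y | star u * y * u ∈ G} = (fun g => u * g * star u) '' G := by
      ext y
      constructor
      · intro hy
        refine ⟨_, hy, ?_⟩
        show u * (star u * y * u) * star u = y
        calc u * (star u * y * u) * star u = (u * star u) * y * (u * star u) := by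
              simp only [mul_assoc]
          _ = y := by rw [h2]; simp
      · rintro ⟨g, hg, rfl⟩
        show star u * (u * g * star u) * u ∈ G
        have : star u * (u * g * star u) * u = (star u * u) * g * (star u * u) := by
              simp only [mul_assoc]
        rw [this, h1]; simpa using hg
    have hconn' : IsPreconnected {y | star u * y * u ∈ G} := by
      rw [himg]
      exact hconn.image _ (by fun_prop : Continuous (fun g : Quat => u * g * star u)).continuousOn
    refine ⟨u, hu, _, himg, ?_⟩
    have hlie : ∀ y ∈ lieAlg hG', star u * y * u ∈ lieAlg hG := by
      intro y hy t
      have h3 := hy t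
      have hi : u⁻¹ = star u := (eq_inv_of_mul_eq_one_left h1).symm
      have hi' : (star u)⁻¹ = u := by rw [← hi, inv_inv]
      have hu0 : star u ≠ 0 := by intro h; rw [h, zero_mul] at h1; exact zero_ne_one h1
      have h4 := NormedSpace.exp_conj (star u) (t • y) hu0
      rw [hi'] at h4
      rw [mul_smul_comm, smul_mul_assoc] at h4
      rw [h4]
      exact h3
    have hc : ∀ y ∈ lieAlg hG', y.imJ = 0 ∧ y.imK = 0 := by
      intro y hy
      have hy' := hlie y hy
      by_cases hxi : x.im = 0
      · have h3 := hxn hxi _ hy'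
        obtain ⟨r, hr⟩ : ∃ r : ℝ, star u * y * u = (r : Quat) := by
          refine ⟨(star u * y * u).re, ?_⟩
          have := Quaternion.re_add_im (star u * y * u)
          rw [h3, add_zero] at this
          exact this.symm
        have h4 : y = (r : Quat) := by
          calc y = (u * star u) * y * (u * star u) := by rw [h2]; simp
            _ = u * (star u * y * u) * star u := by simp only [mul_assoc]
            _ = (r : Quat) := by
              rw [hr, ← Quaternion.coe_commutes, mul_assoc, h2, mul_one]
        rw [h4]; simp
      · have h3 := hcm _ hx _ hy'
        set w := u * x * star u with hw
        have hwy : w * y = y * w := by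
          calc w * y = u * x * star u * y * (u * star u) := by rw [h2]; simp [hw]
            _ = u * (x * (star u * y * u)) * star u := by simp only [mul_assoc]
            _ = u * ((star u * y * u) * x) * star u := by rw [h3]
            _ = (u * star u) * y * (u * x * star u) := by simp only [mul_assoc]
            _ = y * w := by rw [h2]; simp [hw]
        have hwI : w.imI ≠ 0 := by
          intro h0
          apply hxi
          have h4 : w = (w.re : Quat) := by ext <;> simp [h0, hJ, hK]
          have h5 : x = (w.re : Quat) := by
            calc x = (star u * u) * x * (star u * u) := by rw [h1]; simp
              _ = star u * w * u := by simp only [hw, mul_assoc]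
              _ = (w.re : Quat) := by
                rw [h4, ← Quaternion.coe_commutes, mul_assoc, h1, mul_one]; simp
          rw [h5]; simp
        have e1 := congrArg (fun q : Quat => q.imJ) hwy
        have e2 := congrArg (fun q : Quat => q.imK) hwy
        simp [Quaternion.imJ_mul, Quaternion.imK_mul, hJ, hK] at e1 e2
        constructor
        · have : w.imI * y.imJ = 0 := by linarith
          exact (mul_eq_zero.1 this).resolve_left hwI
        · have : w.imI * y.imK = 0 := by linarith
          exact (mul_eq_zero.1 this).resolve_left hwI
    rcases classify_comm hG' hconn' hc with h | h | h | h | h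
    · exact Or.inl h
    · exact Or.inr (Or.inl h)
    · exact Or.inr (Or.inr (Or.inr (Or.inl h)))
    · exact Or.inr (Or.inr (Or.inr (Or.inr (Or.inl h))))
    · exact Or.inr (Or.inr (Or.inr (Or.inr (Or.inr (Or.inr h)))))
  · push Not at hcm
    obtain ⟨x, hx, y, hy, hxy⟩ := hcm
    refine ⟨1, by simp, G, by simp, ?_⟩
    rcases classify_nc hG hconn x y hx hy hxy with h | h
    · exact Or.inr (Or.inr (Or.inl h))
    · exact Or.inr (Or.inr (Or.inr (Or.inr (Or.inr (Or.inl h)))))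

/-! ### The Hermitian form of signature (1,n) -/

/-- column vectors -/
abbrev QV (n : ℕ) := Fin (n + 1) → Quat
/-- square matrices -/
abbrev QM (n : ℕ) := Matrix (Fin (n + 1)) (Fin (n + 1)) Quat

/-- right multiplication of a vector by a scalar -/
abbrev rs {n : ℕ} (v : QV n) (c : Quat) : QV n := MulOpposite.op c • v

theorem rs_apply {n : ℕ} (v : QV n) (c : Quat) (i : Fin (n + 1)) : rs v c i = v i * c := rfl

theorem rs_rs {n : ℕ} (v : QV n) (c d : Quat) : rs (rs v c) d = rs v (c * d) := by
  funext i; simp only [rs_apply, mul_assoc]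

theorem rs_one {n : ℕ} (v : QV n) : rs v 1 = v := by
  funext i; simp only [rs_apply, mul_one]

theorem mulVec_rs {n : ℕ} (A : QM n) (v : QV n) (c : Quat) : A *ᵥ (rs v c) = rs (A *ᵥ v) c :=
  Matrix.mulVec_smul _ _ _

/-- the Hermitian form -/
def hf {n : ℕ} (x y : QV n) : Quat :=
  -(star (x 0) * y 0) + ∑ i : Fin n, star (x i.succ) * y i.succ

theorem hf_eq {n : ℕ} (x y : QV n) : hf x y = star x ⬝ᵥ (eta n *ᵥ y) := by
  unfold hf eta
  simp only [dotProduct, Matrix.mulVec_diagonal, Fin.sum_univ_succ]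
  simp [Fin.succ_ne_zero]

theorem hf_Sp {n : ℕ} {A : QM n} (hA : A ∈ Sp n) (x y : QV n) : hf (A *ᵥ x) (A *ᵥ y) = hf x y := by
  rw [hf_eq, hf_eq, Matrix.star_mulVec, ← Matrix.dotProduct_mulVec, Matrix.mulVec_mulVec,
    Matrix.mulVec_mulVec]
  have : Aᴴ * eta n * A = eta n := hA
  rw [this]

theorem hf_add_right {n : ℕ} (x y z : QV n) : hf x (y + z) = hf x y + hf x z := by
  simp only [hf_eq, Matrix.mulVec_add, dotProduct_add]

theorem hf_add_left {n : ℕ} (x y z : QV n) : hf (x + y) z = hf x z + hf y z := by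
  simp only [hf_eq, star_add, add_dotProduct]

theorem hf_rs_right {n : ℕ} (x y : QV n) (c : Quat) : hf x (rs y c) = hf x y * c := by
  simp only [hf, rs_apply, add_mul, Finset.sum_mul, mul_assoc, neg_mul]

theorem hf_star {n : ℕ} (x y : QV n) : star (hf x y) = hf y x := by
  simp only [hf, star_add, star_neg, star_sum, star_mul, star_star]

theorem hf_rs_left {n : ℕ} (x y : QV n) (c : Quat) : hf (rs x c) y = star c * hf x y := by
  rw [← hf_star, hf_rs_right, star_mul, hf_star]

theorem hf_neg_right {n : ℕ} (x y : QV n) : hf x (-y) = -hf x y := by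
  simp only [hf_eq, Matrix.mulVec_neg, dotProduct_neg]

theorem hf_sub_right {n : ℕ} (x y z : QV n) : hf x (y - z) = hf x y - hf x z := by
  rw [sub_eq_add_neg, hf_add_right, hf_neg_right, ← sub_eq_add_neg]

theorem hf_zero_right {n : ℕ} (x : QV n) : hf x 0 = 0 := by
  simp [hf]

theorem hf_zero_left {n : ℕ} (x : QV n) : hf 0 x = 0 := by
  simp [hf]

theorem hf_sum_right {n : ℕ} {ι : Type} (s : Finset ι) (x : QV n) (f : ι → QV n) :
    hf x (∑ i ∈ s, f i) = ∑ i ∈ s, hf x (f i) := by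
  classical
  induction s using Finset.induction_on with
  | empty => simp [hf_zero_right]
  | insert a s ha ih => rw [Finset.sum_insert ha, Finset.sum_insert ha, hf_add_right, ih]

/-- the quadratic form -/
def Qf {n : ℕ} (x : QV n) : ℝ := -‖x 0‖ ^ 2 + ∑ i : Fin n, ‖x i.succ‖ ^ 2

theorem q_star_mul_self (a : Quat) : star a * a = ((‖a‖ ^ 2 : ℝ) : Quat) := by
  rw [Quaternion.star_mul_self, Quaternion.normSq_eq_norm_mul_self, sq]

theorem hf_self {n : ℕ} (x : QV n) : hf x x = (Qf x : Quat) := by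
  simp only [hf, Qf, q_star_mul_self]
  have hs : ∀ (s : Finset (Fin n)) (f : Fin n → ℝ), ((∑ i ∈ s, f i : ℝ) : Quat) = ∑ i ∈ s, ((f i : ℝ) : Quat) := by
    intro s f
    induction s using Finset.induction_on with
    | empty => simp
    | insert a s ha ih => rw [Finset.sum_insert ha, Finset.sum_insert ha, ← ih, Quaternion.coe_add]
  rw [Quaternion.coe_add, hs, Quaternion.coe_neg]

theorem Qf_re {n : ℕ} (x : QV n) : Qf x = (hf x x).re := by rw [hf_self]; simp

theorem Qf_Sp {n : ℕ} {A : QM n} (hA : A ∈ Sp n) (x : QV n) : Qf (A *ᵥ x) = Qf x := by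
  rw [Qf_re, Qf_re, hf_Sp hA]

theorem Qf_zero {n : ℕ} : Qf (0 : QV n) = 0 := by simp [Qf]

theorem Qf_add_rs {n : ℕ} (x y : QV n) (c : Quat) :
    Qf (x + rs y c) = Qf x + ‖c‖ ^ 2 * Qf y + 2 * (hf x y * c).re := by
  rw [Qf_re]
  simp only [hf_add_left, hf_add_right, hf_rs_left, hf_rs_right]
  have h1 : star c * hf y x = star (hf x y * c) := by rw [star_mul, hf_star]
  have h2 : star c * hf y y * c = ((‖c‖ ^ 2 * Qf y : ℝ) : Quat) := by
    rw [hf_self, mul_assoc, Quaternion.coe_commutes, ← mul_assoc, q_star_mul_self, Quaternion.coe_mul]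
  rw [add_mul, h1, h2, hf_self x]
  simp only [Quaternion.re_add, Quaternion.re_star, Quaternion.re_coe]
  ring

theorem Qf_rs {n : ℕ} (y : QV n) (c : Quat) : Qf (rs y c) = ‖c‖ ^ 2 * Qf y := by
  have := Qf_add_rs 0 y c
  rw [zero_add, Qf_zero, hf_zero_left] at this
  simpa using this

theorem Qf_zero_coord {n : ℕ} (y : QV n) (h0 : y 0 = 0) : 0 ≤ Qf y ∧ (Qf y = 0 → y = 0) := by
  have hQ : Qf y = ∑ i : Fin n, ‖y i.succ‖ ^ 2 := by simp [Qf, h0]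
  rw [hQ]
  refine ⟨Finset.sum_nonneg fun i _ => by positivity, fun h => ?_⟩
  rw [Finset.sum_eq_zero_iff_of_nonneg (fun i _ => by positivity)] at h
  funext i
  refine Fin.cases h0 (fun j => ?_) i
  have := h j (Finset.mem_univ _)
  simpa using this

theorem key_lemma {n : ℕ} (x y : QV n) (hx : x ≠ 0) (hQ : Qf x ≤ 0) (hxy : hf x y = 0) :
    0 ≤ Qf y ∧ (Qf y = 0 → ∃ c, y = rs x c) ∧ (Qf x < 0 → y ≠ 0 → 0 < Qf y) := by
  have hx0 : x 0 ≠ 0 := by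
    intro h
    obtain ⟨h1, h2⟩ := Qf_zero_coord x h
    exact hx (h2 (le_antisymm hQ h1))
  set c : Quat := (x 0)⁻¹ * y 0 with hc
  have hyx : hf y x = 0 := by rw [← hf_star, hxy, star_zero]
  have hz0 : (y + rs x (-c)) 0 = 0 := by
    rw [Pi.add_apply, rs_apply, hc, mul_neg, mul_inv_cancel_left₀ hx0, add_neg_cancel]
  obtain ⟨h1, h2⟩ := Qf_zero_coord _ hz0
  have h3 := Qf_add_rs y x (-c)
  rw [hyx, zero_mul, norm_neg] at h3
  simp at h3
  have h4 : 0 ≤ ‖c‖ ^ 2 * (-Qf x) := mul_nonneg (by positivity) (by linarith)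
  have hback : y + rs x (-c) = 0 → y = rs x c := by
    intro h
    funext i
    have := congrFun h i
    rw [Pi.add_apply, rs_apply, mul_neg, Pi.zero_apply] at this
    rw [rs_apply]
    exact eq_of_sub_eq_zero (by rw [sub_eq_add_neg]; exact this)
  refine ⟨by linarith, fun h => ⟨c, hback (h2 (by linarith))⟩, fun hneg hy => ?_⟩
  by_contra hcon
  have h5 : y = rs x c := hback (h2 (by linarith))
  have h6 : ‖c‖ ^ 2 * (-Qf x) = 0 := by linarith
  have h7 : ‖c‖ ^ 2 = 0 := (mul_eq_zero.1 h6).resolve_right (by linarith)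
  have h8 : c = 0 := by simpa using h7
  apply hy
  rw [h5, h8]; funext i; simp [rs_apply]

theorem finrank_QV (n : ℕ) : Module.finrank Quatᵐᵒᵖ (QV n) = n + 1 := by
  have h1 : Module.finrank Quatᵐᵒᵖ Quat = 1 := by
    let e : Quat ≃ₗ[Quatᵐᵒᵖ] Quatᵐᵒᵖ :=
      { MulOpposite.opAddEquiv with
        map_smul' := fun c x => rfl }
    rw [e.finrank_eq, Module.finrank_self]
  have hfin : Module.Finite Quatᵐᵒᵖ Quat := Module.finite_of_finrank_eq_succ h1
  have hfree : Module.Free Quatᵐᵒᵖ Quat := inferInstance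
  rw [Module.finrank_pi_fintype]
  simp [h1]

theorem span_ne_top {n k : ℕ} (hk : k < n + 1) (f : Fin k → QV n) :
    Submodule.span Quatᵐᵒᵖ (Set.range f) ≠ ⊤ := by
  intro h
  have h1 := finrank_range_le_card (R := Quatᵐᵒᵖ) f
  rw [Set.finrank, h, finrank_top, finrank_QV, Fintype.card_fin] at h1
  omega

theorem exists_orth {n : ℕ} (W : Submodule Quatᵐᵒᵖ (QV n)) (hW : W ≠ ⊤) :
    ∃ y : QV n, y ≠ 0 ∧ ∀ w ∈ W, hf y w = 0 := by
  obtain ⟨f, hf0, hfW⟩ := Submodule.exists_le_ker_of_lt_top W (lt_top_iff_ne_top.2 hW)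
  let a : Fin (n + 1) → Quat := fun i => MulOpposite.unop (f (Pi.single i 1))
  have hfa : ∀ w : QV n, MulOpposite.unop (f w) = ∑ i, a i * w i := by
    intro w
    have hw : w = ∑ i, MulOpposite.op (w i) • (Pi.single i 1 : QV n) := by
      funext j
      rw [Finset.sum_apply]
      simp [Pi.single_apply]
    conv_lhs => rw [hw, map_sum]
    rw [Finset.unop_sum]
    refine Finset.sum_congr rfl fun i _ => ?_
    rw [map_smul]; rfl
  let y : QV n := fun i => if i = 0 then -star (a i) else star (a i)
  have hy : ∀ w, hf y w = ∑ i, a i * w i := by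
    intro w
    rw [Fin.sum_univ_succ]
    simp [hf, y, Fin.succ_ne_zero]
  refine ⟨y, fun h => hf0 ?_, fun w hw => ?_⟩
  · refine LinearMap.ext fun w => ?_
    apply MulOpposite.unop_injective
    rw [hfa, ← hy, h, hf_zero_left]; rfl
  · rw [hy, ← hfa]
    have := hfW hw
    rw [LinearMap.mem_ker] at this
    rw [this]; rfl

/-! ### Bounded orbits -/

/-- The pair consisting of an irreducible group `H` and a normal subgroup `G`. -/
structure Ctx (n : ℕ) (H G : Set (QM n)) : Prop where
  subH : H ⊆ Sp n
  irr : ActsHIrreducibly n H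
  GH : G ⊆ H
  one : (1 : QM n) ∈ G
  mul : ∀ A ∈ G, ∀ B ∈ G, A * B ∈ G
  inv : ∀ A ∈ G, ∃ B ∈ G, A * B = 1 ∧ B * A = 1
  Hmul : ∀ A ∈ H, ∀ B ∈ H, A * B ∈ H
  normal : ∀ h ∈ H, ∃ k ∈ H, h * k = 1 ∧ k * h = 1 ∧ ∀ g ∈ G, k * g * h ∈ G

theorem norm_rs_le {n : ℕ} (v : QV n) (c : Quat) : ‖rs v c‖ ≤ ‖c‖ * ‖v‖ := by
  rw [pi_norm_le_iff_of_nonneg (by positivity)]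
  intro i
  rw [rs_apply, norm_mul, mul_comm]
  exact mul_le_mul_of_nonneg_left (norm_le_pi_norm v i) (norm_nonneg _)

theorem norm_mulVec_le {n : ℕ} (A : QM n) (v : QV n) :
    ‖A *ᵥ v‖ ≤ (∑ i, ∑ j, ‖A i j‖) * ‖v‖ := by
  have hnn : 0 ≤ ∑ i, ∑ j, ‖A i j‖ :=
    Finset.sum_nonneg fun i _ => Finset.sum_nonneg fun j _ => norm_nonneg _
  rw [pi_norm_le_iff_of_nonneg (by positivity)]
  intro i
  have h1 : ‖(A *ᵥ v) i‖ ≤ ∑ j, ‖A i j‖ * ‖v‖ := by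
    have h0 : (A *ᵥ v) i = ∑ j, A i j * v j := rfl
    rw [h0]
    refine (norm_sum_le Finset.univ fun j => A i j * v j).trans (Finset.sum_le_sum fun j _ => ?_)
    rw [norm_mul]
    exact mul_le_mul_of_nonneg_left (norm_le_pi_norm v j) (norm_nonneg _)
  rw [← Finset.sum_mul] at h1
  refine h1.trans (mul_le_mul_of_nonneg_right ?_ (norm_nonneg _))
  exact Finset.single_le_sum (f := fun i => ∑ j, ‖A i j‖)
    (fun i _ => Finset.sum_nonneg fun j _ => norm_nonneg _) (Finset.mem_univ i)

theorem continuous_mulVec' {n : ℕ} (A : QM n) : Continuous fun v : QV n => A *ᵥ v := by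
  refine continuous_pi fun i => ?_
  simp only [Matrix.mulVec, dotProduct]
  fun_prop

theorem continuous_Qf {n : ℕ} : Continuous (Qf : QV n → ℝ) := by
  unfold Qf
  fun_prop

theorem rsmul_eq {n : ℕ} (t : ℝ) (v : QV n) : t • v = rs v (t : Quat) := by
  funext i
  rw [rs_apply, Pi.smul_apply, ← Quaternion.coe_commutes, Quaternion.coe_mul_eq_smul]

theorem Qf_rsmul {n : ℕ} (t : ℝ) (v : QV n) : Qf (t • v) = t ^ 2 * Qf v := by
  rw [rsmul_eq, Qf_rs, Quaternion.norm_coe, Real.norm_eq_abs, sq_abs]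

/-- the underlying real subspace -/
def realSub {n : ℕ} (U : Submodule Quatᵐᵒᵖ (QV n)) : Submodule ℝ (QV n) where
  carrier := U
  add_mem' := fun ha hb => U.add_mem ha hb
  zero_mem' := U.zero_mem
  smul_mem' := fun t x hx => by
    rw [rsmul_eq]
    exact U.smul_mem _ hx

theorem posdef_bounded {n : ℕ} {H G : Set (QM n)} (hc : Ctx n H G)
    (U : Submodule Quatᵐᵒᵖ (QV n)) (hinv : ∀ g ∈ G, ∀ u ∈ U, g *ᵥ u ∈ U)
    (hpos : ∀ u ∈ U, u ≠ 0 → 0 < Qf u) (u : QV n) (hu : u ∈ U) :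
    ∃ C : ℝ, ∀ g ∈ G, ‖g *ᵥ u‖ ≤ C := by
  have hUc : IsClosed (U : Set (QV n)) := (realSub U).closed_of_finiteDimensional
  have hcomp : IsCompact ((U : Set (QV n)) ∩ Metric.sphere 0 1) :=
    (isCompact_sphere (0 : QV n) 1).inter_left hUc
  have hmin : ∃ m : ℝ, 0 < m ∧ ∀ x ∈ (U : Set (QV n)) ∩ Metric.sphere 0 1, m ≤ Qf x := by
    rcases ((U : Set (QV n)) ∩ Metric.sphere 0 1).eq_empty_or_nonempty with he | hne
    · exact ⟨1, one_pos, fun x hx => by rw [he] at hx; exact absurd hx (Set.notMem_empty _)⟩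
    · obtain ⟨x, hx, hmx⟩ := hcomp.exists_isMinOn hne continuous_Qf.continuousOn
      refine ⟨Qf x, hpos x hx.1 ?_, fun y hy => hmx hy⟩
      intro h0
      have := hx.2
      rw [h0] at this
      simp at this
  obtain ⟨m, hm, hmin⟩ := hmin
  have hlow : ∀ x ∈ U, m * ‖x‖ ^ 2 ≤ Qf x := by
    intro x hx
    by_cases h0 : x = 0
    · rw [h0, Qf_zero]; simp
    · have hn : 0 < ‖x‖ := norm_pos_iff.2 h0
      have h1 : m ≤ Qf (‖x‖⁻¹ • x) := by
        refine hmin _ ⟨(realSub U).smul_mem _ hx, ?_⟩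
        rw [mem_sphere_zero_iff_norm, norm_smul, norm_inv, norm_norm, inv_mul_cancel₀ hn.ne']
      rw [Qf_rsmul, inv_pow] at h1
      rw [inv_mul_eq_div, le_div_iff₀ (by positivity)] at h1
      exact h1
  refine ⟨Real.sqrt (Qf u / m), fun g hg => ?_⟩
  apply Real.le_sqrt_of_sq_le
  rw [le_div_iff₀ hm, mul_comm]
  have := hlow _ (hinv g hg u hu)
  rwa [Qf_Sp (hc.subH (hc.GH hg))] at this

theorem all_bounded {n : ℕ} {H G : Set (QM n)} (hc : Ctx n H G) (u : QV n) (hu : u ≠ 0)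
    (hb : ∃ C : ℝ, ∀ g ∈ G, ‖g *ᵥ u‖ ≤ C) (x : QV n) : ∃ C : ℝ, ∀ g ∈ G, ‖g *ᵥ x‖ ≤ C := by
  let B : Submodule Quatᵐᵒᵖ (QV n) :=
    { carrier := {x | ∃ C : ℝ, ∀ g ∈ G, ‖g *ᵥ x‖ ≤ C}
      add_mem' := by
        rintro a b ⟨C, hC⟩ ⟨D, hD⟩
        refine ⟨C + D, fun g hg => ?_⟩
        rw [Matrix.mulVec_add]
        exact (norm_add_le _ _).trans (add_le_add (hC g hg) (hD g hg))
      zero_mem' := ⟨0, fun g _ => by rw [Matrix.mulVec_zero, norm_zero]⟩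
      smul_mem' := by
        rintro c x ⟨C, hC⟩
        refine ⟨‖c.unop‖ * C, fun g hg => ?_⟩
        have h1 : g *ᵥ (c • x) = rs (g *ᵥ x) c.unop := mulVec_rs g x c.unop
        rw [h1]
        exact (norm_rs_le _ _).trans (mul_le_mul_of_nonneg_left (hC g hg) (norm_nonneg _)) }
  have hB : ∀ A ∈ H, ∀ v ∈ B, A *ᵥ v ∈ B := by
    rintro h hh v ⟨C, hC⟩
    obtain ⟨k, hk, hhk, hkh, hn⟩ := hc.normal h hh
    refine ⟨(∑ i, ∑ j, ‖h i j‖) * C, fun g hg => ?_⟩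
    have h1 : g *ᵥ (h *ᵥ v) = h *ᵥ ((k * g * h) *ᵥ v) := by
      rw [Matrix.mulVec_mulVec, Matrix.mulVec_mulVec]
      congr 1
      rw [← mul_assoc, ← mul_assoc, hhk, one_mul]
    rw [h1]
    exact (norm_mulVec_le _ _).trans (mul_le_mul_of_nonneg_left (hC _ (hn g hg))
      (Finset.sum_nonneg fun i _ => Finset.sum_nonneg fun j _ => norm_nonneg _))
  rcases hc.irr B hB with h | h
  · exfalso
    have : u ∈ B := hb
    rw [h] at this
    exact hu ((Submodule.mem_bot _).1 this)
  · have : x ∈ B := by rw [h]; trivial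
    exact this

/-- the invariant norm -/
def Fn {n : ℕ} (G : Set (QM n)) (x : QV n) : ℝ := ⨆ g : G, ‖(g : QM n) *ᵥ x‖

section FnS
variable {n : ℕ} {G : Set (QM n)}

theorem Fn_bdd (hb : ∀ x : QV n, ∃ C : ℝ, ∀ g ∈ G, ‖g *ᵥ x‖ ≤ C) (x : QV n) :
    BddAbove (Set.range fun g : G => ‖(g : QM n) *ᵥ x‖) := by
  obtain ⟨C, hC⟩ := hb x
  exact ⟨C, by rintro _ ⟨g, rfl⟩; exact hC g g.2⟩

theorem le_Fn (hb : ∀ x : QV n, ∃ C : ℝ, ∀ g ∈ G, ‖g *ᵥ x‖ ≤ C) (x : QV n) (g : QM n) (hg : g ∈ G) :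
    ‖g *ᵥ x‖ ≤ Fn G x := le_ciSup (Fn_bdd hb x) ⟨g, hg⟩

theorem Fn_le (h1 : (1 : QM n) ∈ G) (x : QV n) (C : ℝ) (h : ∀ g ∈ G, ‖g *ᵥ x‖ ≤ C) : Fn G x ≤ C := by
  haveI : Nonempty G := ⟨⟨1, h1⟩⟩
  exact ciSup_le fun g => h g g.2

end FnS

theorem two_neg {n : ℕ} (v w : QV n) (hv : Qf v < 0) (hw : Qf w < 0) : hf v w ≠ 0 := by
  intro h
  have hv0 : v ≠ 0 := by rintro rfl; rw [Qf_zero] at hv; exact lt_irrefl _ hv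
  have := (key_lemma v w hv0 hv.le h).1
  linarith

theorem neg_line {n : ℕ} {H G : Set (QM n)} (hc : Ctx n H G)
    (hb : ∀ x : QV n, ∃ C : ℝ, ∀ g ∈ G, ‖g *ᵥ x‖ ≤ C) :
    ∃ v : QV n, Qf v = -1 ∧ ∀ g ∈ G, ∃ c, g *ᵥ v = rs v c := by
  have hlsc : LowerSemicontinuous (Fn G) := by
    refine lowerSemicontinuous_ciSup (fun x => Fn_bdd hb x) fun g => ?_
    exact (continuous_mulVec' g.1).norm.lowerSemicontinuous
  have hge : ∀ x, ‖x‖ ≤ Fn G x := fun x => by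
    have := le_Fn hb x 1 hc.one
    rwa [Matrix.one_mulVec] at this
  let e : QV n := Pi.single 0 1
  have he : Qf e = -1 := by simp [Qf, e]
  have hcomp : IsCompact ({x : QV n | Qf x = -1} ∩ Metric.closedBall 0 (Fn G e)) :=
    (isCompact_closedBall (0 : QV n) _).inter_left (isClosed_eq continuous_Qf continuous_const)
  obtain ⟨v, hv, hmin⟩ := LowerSemicontinuousOn.exists_isMinOn
    (⟨e, he, by rw [mem_closedBall_zero_iff]; exact hge e⟩ :
      ({x : QV n | Qf x = -1} ∩ Metric.closedBall 0 (Fn G e)).Nonempty) hcomp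
    (hlsc.lowerSemicontinuousOn _)
  have hmin' : ∀ x : QV n, Qf x = -1 → Fn G v ≤ Fn G x := by
    intro x hx
    by_cases hx' : x ∈ Metric.closedBall (0 : QV n) (Fn G e)
    · exact hmin ⟨hx, hx'⟩
    · rw [mem_closedBall_zero_iff, not_le] at hx'
      have h1 : Fn G v ≤ Fn G e := hmin ⟨he, by rw [mem_closedBall_zero_iff]; exact hge e⟩
      exact h1.trans (hx'.le.trans (hge x))
  have hQv : Qf v = -1 := hv.1
  have hv0 : v ≠ 0 := by rintro rfl; rw [Qf_zero] at hQv; norm_num at hQv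
  refine ⟨v, hQv, fun g hg => ?_⟩
  set w := g *ᵥ v with hw
  have hQw : Qf w = -1 := by rw [hw, Qf_Sp (hc.subH (hc.GH hg)), hQv]
  have hFw : ∀ k ∈ G, ‖k *ᵥ w‖ ≤ Fn G v := by
    intro k hk
    rw [hw, Matrix.mulVec_mulVec]
    exact le_Fn hb v _ (hc.mul k hk g hg)
  set s := hf v w with hs
  have hs0 : s ≠ 0 := two_neg v w (by linarith) (by linarith)
  have hspos : 0 < ‖s‖ := norm_pos_iff.2 hs0
  by_cases hw' : w + rs v s = 0
  · refine ⟨-s, ?_⟩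
    rw [eq_neg_of_add_eq_zero_left hw']
    funext i
    simp [rs_apply]
  exfalso
  have horth : hf v (w + rs v s) = 0 := by
    rw [hf_add_right, hf_rs_right, hf_self, hQv, ← hs]
    simp
  have hp := (key_lemma v _ hv0 (by linarith) horth).2.2 (by linarith) hw'
  have hwv : hf w v * s = ((‖s‖ ^ 2 : ℝ) : Quat) := by
    rw [← hf_star, ← hs, q_star_mul_self]
  rw [Qf_add_rs, hwv, hQw, hQv, Quaternion.re_coe] at hp
  have hs1 : 1 < ‖s‖ := by nlinarith
  set q : Quat := (-(‖s‖⁻¹) : ℝ) • star s with hq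
  have hqn : ‖q‖ = 1 := by
    rw [hq, norm_smul, norm_star, norm_neg, norm_inv, norm_norm, inv_mul_cancel₀ hspos.ne']
  have hsq : hf v w * q = ((-‖s‖ : ℝ) : Quat) := by
    rw [hq, ← hs, mul_smul_comm]
    have := q_star_mul_self (star s)
    rw [star_star, norm_star] at this
    rw [this, ← Quaternion.coe_smul]
    congr 1
    rw [smul_eq_mul]
    field_simp
  have hQm : Qf (v + rs w q) = -2 - 2 * ‖s‖ := by
    rw [Qf_add_rs, hsq, hqn, hQv, hQw, Quaternion.re_coe]; ring
  set m := v + rs w q with hm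
  have hFm : ∀ k ∈ G, ‖k *ᵥ m‖ ≤ 2 * Fn G v := by
    intro k hk
    rw [hm, Matrix.mulVec_add, mulVec_rs]
    have h1 := le_Fn hb v k hk
    have h2 := norm_rs_le (k *ᵥ w) q
    rw [hqn, one_mul] at h2
    have h3 := hFw k hk
    have h4 := norm_add_le (k *ᵥ v) (rs (k *ᵥ w) q)
    linarith
  set r : ℝ := Real.sqrt (2 + 2 * ‖s‖) with hr
  have hr2 : r ^ 2 = 2 + 2 * ‖s‖ := Real.sq_sqrt (by positivity)
  have hr0 : 0 ≤ r := Real.sqrt_nonneg _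
  have hr1 : 2 < r := by nlinarith
  have hFv : 0 < Fn G v := lt_of_lt_of_le (norm_pos_iff.2 hv0) (hge v)
  have hfin : Fn G v ≤ Fn G (r⁻¹ • m) := by
    apply hmin'
    rw [Qf_rsmul, hQm, inv_pow, hr2]
    field_simp
    ring
  have hfin2 : Fn G (r⁻¹ • m) ≤ r⁻¹ * (2 * Fn G v) := by
    refine Fn_le hc.one _ _ fun k hk => ?_
    rw [Matrix.mulVec_smul, norm_smul, norm_inv, Real.norm_eq_abs, abs_of_nonneg hr0]
    exact mul_le_mul_of_nonneg_left (hFm k hk) (by positivity)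
  have h5 : r⁻¹ * (2 * Fn G v) < Fn G v := by
    rw [inv_mul_lt_iff₀ (by linarith)]
    nlinarith
  linarith
/-! ### The case of a fixed negative line -/

/-- matrix with prescribed columns -/
def colM {n : ℕ} (p : Fin (n + 1) → QV n) : QM n := fun a j => p j a

theorem colM_Sp {n : ℕ} (p : Fin (n + 1) → QV n) (h : ∀ i j, hf (p i) (p j) = eta n i j) :
    colM p ∈ Sp n := by
  change (colM p)ᴴ * eta n * colM p = eta n
  rw [mul_assoc]
  ext1 i j
  rw [← h i j, hf_eq]
  rfl

theorem mul_colM {n : ℕ} (g : QM n) (p : Fin (n + 1) → QV n) (a j : Fin (n + 1)) :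
    (g * colM p) a j = (g *ᵥ p j) a := rfl

/-- `A` as a right-linear map -/
def mvL {n : ℕ} (A : QM n) : QV n →ₗ[Quatᵐᵒᵖ] QV n where
  toFun := fun v => A *ᵥ v
  map_add' := fun x y => Matrix.mulVec_add _ _ _
  map_smul' := fun c x => Matrix.mulVec_smul _ _ _

theorem orbit_span {n : ℕ} {H G : Set (QM n)} (hc : Ctx n H G) (v : QV n) (hv : v ≠ 0)
    (S : Submodule Quatᵐᵒᵖ (QV n)) (hS : ∀ h ∈ H, h *ᵥ v ∈ S) : S = ⊤ := by
  let T : Submodule Quatᵐᵒᵖ (QV n) := Submodule.span Quatᵐᵒᵖ ((fun h : QM n => h *ᵥ v) '' H)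
  have hTS : T ≤ S := by
    rw [Submodule.span_le]
    rintro _ ⟨h, hh, rfl⟩
    exact hS h hh
  have hT : ∀ A ∈ H, ∀ x ∈ T, A *ᵥ x ∈ T := by
    intro A hA
    have : T ≤ T.comap (mvL A) := by
      rw [Submodule.span_le]
      rintro _ ⟨h, hh, rfl⟩
      refine Submodule.subset_span ⟨A * h, hc.Hmul A hA h hh, ?_⟩
      exact (Matrix.mulVec_mulVec _ _ _).symm
    exact fun x hx => this hx
  rcases hc.irr T hT with h | h
  · exfalso
    have : v ∈ T := Submodule.subset_span ⟨1, hc.GH hc.one, Matrix.one_mulVec v⟩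
    rw [h] at this
    exact hv ((Submodule.mem_bot _).1 this)
  · rw [eq_top_iff, ← h]; exact hTS

/-- vectors on which all elements act by the same scalars -/
def Eset {n : ℕ} (G : Set (QM n)) (q : QM n → Quat) : AddSubgroup (QV n) where
  carrier := {x | ∀ g ∈ G, g *ᵥ x = rs x (q g)}
  add_mem' := by
    intro a b ha hb g hg
    rw [Matrix.mulVec_add, ha g hg, hb g hg, ← smul_add]
  zero_mem' := by
    intro g _
    rw [Matrix.mulVec_zero]
    exact (smul_zero _).symm
  neg_mem' := by
    intro a ha g hg
    rw [Matrix.mulVec_neg, ha g hg]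
    exact (smul_neg _ _).symm

theorem Eset_rs {n : ℕ} {G : Set (QM n)} {q : QM n → Quat} {x : QV n} (hx : x ∈ Eset G q) (c : Quat)
    (hcomm : ∀ g ∈ G, q g * c = c * q g) : rs x c ∈ Eset G q := by
  intro g hg
  rw [mulVec_rs, hx g hg, rs_rs, rs_rs, hcomm g hg]

theorem Eset_comm {n : ℕ} {H G : Set (QM n)} (hc : Ctx n H G) {q : QM n → Quat}
    (hq : ∀ g ∈ G, ‖q g‖ = 1) {x y : QV n} (hx : x ∈ Eset G q) (hy : y ∈ Eset G q) :
    ∀ g ∈ G, q g * hf x y = hf x y * q g := by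
  intro g hg
  have h1 := hf_Sp (hc.subH (hc.GH hg)) x y
  rw [hx g hg, hy g hg, hf_rs_right, hf_rs_left] at h1
  calc q g * hf x y = q g * (star (q g) * hf x y * q g) := by rw [h1]
    _ = (q g * star (q g)) * hf x y * q g := by simp only [mul_assoc]
    _ = hf x y * q g := by rw [q_mul_star _ (hq g hg), one_mul]

theorem scalar_form {n : ℕ} {H G : Set (QM n)} (hc : Ctx n H G)
    (v : QV n) (hQv : Qf v = -1) (hv : ∀ g ∈ G, ∃ c, g *ᵥ v = rs v c) :
    ∃ P ∈ Sp n, ∀ g ∈ G, ∃ q : Quat, ‖q‖ = 1 ∧ g * P = P * (q • (1 : QM n)) := by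
  have hv0 : v ≠ 0 := by rintro rfl; rw [Qf_zero] at hQv; norm_num at hQv
  let q : QM n → Quat := fun g => -hf v (g *ᵥ v)
  have hgv : ∀ g ∈ G, g *ᵥ v = rs v (q g) := by
    intro g hg
    obtain ⟨c, hc'⟩ := hv g hg
    have : q g = c := by
      simp only [q]
      rw [hc', hf_rs_right, hf_self, hQv]; simp
    rw [this, hc']
  have hqn : ∀ g ∈ G, ‖q g‖ = 1 := by
    intro g hg
    have h1 := Qf_Sp (hc.subH (hc.GH hg)) v
    rw [hgv g hg, Qf_rs, hQv] at h1
    have h2 : ‖q g‖ ^ 2 = 1 := by linarith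
    nlinarith [norm_nonneg (q g)]
  have hvE : v ∈ Eset G q := hgv
  -- the span of E is everything
  have hspan : Submodule.span Quatᵐᵒᵖ (Eset G q : Set (QV n)) = ⊤ := by
    refine orbit_span hc v hv0 _ fun h hh => ?_
    obtain ⟨k, hk, hhk, hkh, hn⟩ := hc.normal h hh
    set w := h *ᵥ v with hw
    have hQw : Qf w = -1 := by rw [hw, Qf_Sp (hc.subH hh), hQv]
    have hcz : hf v w ≠ 0 := two_neg v w (by linarith) (by linarith)
    have hgw : ∀ g ∈ G, g *ᵥ w = rs w (q (k * g * h)) := by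
      intro g hg
      have h1 : g *ᵥ (h *ᵥ v) = h *ᵥ ((k * g * h) *ᵥ v) := by
        rw [Matrix.mulVec_mulVec, Matrix.mulVec_mulVec]
        congr 1
        rw [← mul_assoc, ← mul_assoc, hhk, one_mul]
      rw [hw, h1, hgv _ (hn g hg), mulVec_rs]
    have hmem : rs w (hf v w)⁻¹ ∈ Eset G q := by
      intro g hg
      rw [mulVec_rs, hgw g hg, rs_rs, rs_rs]
      refine congrArg (rs w) ?_
      have h1 := hf_Sp (hc.subH (hc.GH hg)) v w
      rw [hgv g hg, hgw g hg, hf_rs_right, hf_rs_left] at h1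
      have h2 : q g * hf v w = hf v w * q (k * g * h) := by
        calc q g * hf v w = q g * (star (q g) * hf v w * q (k * g * h)) := by rw [h1]
          _ = (q g * star (q g)) * hf v w * q (k * g * h) := by simp only [mul_assoc]
          _ = _ := by rw [q_mul_star _ (hqn g hg), one_mul]
      have h3 : (hf v w)⁻¹ * (q g * hf v w) * (hf v w)⁻¹ =
          (hf v w)⁻¹ * (hf v w * q (k * g * h)) * (hf v w)⁻¹ := by rw [h2]
      rw [inv_mul_cancel_left₀ hcz, mul_assoc, mul_assoc, mul_inv_cancel₀ hcz, mul_one] at h3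
      exact h3.symm
    have h4 : w = rs (rs w (hf v w)⁻¹) (hf v w) := by
      rw [rs_rs, inv_mul_cancel₀ hcz, rs_one]
    rw [h4]
    exact Submodule.smul_mem _ _ (Submodule.subset_span hmem)
  -- Gram-Schmidt
  let ε : ℕ → Quat := fun i => if i = 0 then -1 else 1
  have hεε : ∀ i, ε i * ε i = 1 := by intro i; simp only [ε]; split_ifs <;> simp
  have hεc : ∀ i (a : Quat), a * ε i = ε i * a := by intro i a; simp only [ε]; split_ifs <;> simp
  have hGS : ∀ k ≤ n, ∃ P : ℕ → QV n, P 0 = v ∧ (∀ i ≤ k, P i ∈ Eset G q) ∧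
      ∀ i ≤ k, ∀ j ≤ k, hf (P i) (P j) = if i = j then ε i else 0 := by
    intro k
    induction k with
    | zero =>
      intro _
      refine ⟨fun _ => v, rfl, fun _ _ => hvE, ?_⟩
      intro i hi j hj
      obtain rfl : i = 0 := by omega
      obtain rfl : j = 0 := by omega
      rw [hf_self, hQv]; simp [ε]
    | succ k ih =>
      intro hk
      obtain ⟨P, hP0, hPE, hPP⟩ := ih (by omega)
      have hne := span_ne_top (n := n) (k := k + 1) (by omega) (fun i => P i)
      obtain ⟨x, hxE, hx⟩ : ∃ x ∈ Eset G q, x ∉ Submodule.span Quatᵐᵒᵖ (Set.range fun i : Fin (k + 1) => P i) := by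
        by_contra hcon
        push Not at hcon
        apply hne
        rw [eq_top_iff, ← hspan, Submodule.span_le]
        exact hcon
      set y : QV n := x - ∑ i ∈ Finset.range (k + 1), rs (P i) (ε i * hf (P i) x) with hy
      have hyE : y ∈ Eset G q := by
        refine sub_mem hxE (sum_mem fun i hi => ?_)
        have hi' : i ≤ k := by have := Finset.mem_range.1 hi; omega
        refine Eset_rs (hPE i hi') _ fun g hg => ?_
        have := Eset_comm hc hqn (hPE i hi') hxE g hg
        rw [← mul_assoc, hεc, mul_assoc, this, mul_assoc]
      have hyo : ∀ j ≤ k, hf (P j) y = 0 := by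
        intro j hj
        rw [hy, hf_sub_right, hf_sum_right, Finset.sum_eq_single j]
        · rw [hf_rs_right, hPP j hj j hj, if_pos rfl, ← mul_assoc, hεε, one_mul, sub_self]
        · intro i hi hij
          have hi' : i ≤ k := by have := Finset.mem_range.1 hi; omega
          rw [hf_rs_right, hPP j hj i hi', if_neg (Ne.symm hij), zero_mul]
        · intro hj'
          exact absurd (Finset.mem_range.2 (by omega)) hj'
      have hy0 : y ≠ 0 := by
        intro h0
        apply hx
        rw [hy, sub_eq_zero] at h0
        rw [h0]
        refine Submodule.sum_mem _ fun i hi => Submodule.smul_mem _ _ (Submodule.subset_span ?_)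
        exact ⟨⟨i, Finset.mem_range.1 hi⟩, rfl⟩
      have hvy : hf v y = 0 := by rw [← hP0]; exact hyo 0 (by omega)
      have hQy : 0 < Qf y := (key_lemma v y hv0 (by linarith) hvy).2.2 (by linarith) hy0
      set r : ℝ := (Real.sqrt (Qf y))⁻¹ with hr
      set z : QV n := rs y (r : Quat) with hz
      have hzE : z ∈ Eset G q := Eset_rs hyE _ fun g _ => (Quaternion.coe_commutes _ _).symm
      have hQz : Qf z = 1 := by
        rw [hz, Qf_rs, Quaternion.norm_coe, Real.norm_eq_abs, sq_abs, hr, inv_pow, Real.sq_sqrt hQy.le,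
          inv_mul_cancel₀ hQy.ne']
      have hzo : ∀ j ≤ k, hf (P j) z = 0 := by
        intro j hj
        rw [hz, hf_rs_right, hyo j hj, zero_mul]
      have hzo' : ∀ j ≤ k, hf z (P j) = 0 := by
        intro j hj
        rw [← hf_star, hzo j hj, star_zero]
      refine ⟨fun i => if i = k + 1 then z else P i, by simp [hP0], ?_, ?_⟩
      · intro i hi
        by_cases h : i = k + 1
        · simp only [h, if_true]; exact hzE
        · simp only [h, if_false]; exact hPE i (by omega)
      · intro i hi j hj
        by_cases h : i = k + 1
        · by_cases h' : j = k + 1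
          · subst h; subst h'
            simp only [if_true]
            rw [hf_self, hQz]; simp [ε]
          · simp only [h, if_true, h', if_false]
            rw [if_neg (by omega)]; exact hzo' j (by omega)
        · by_cases h' : j = k + 1
          · simp only [h, if_true, h', if_false]
            exact hzo i (by omega)
          · simp only [h, h', if_false]
            exact hPP i (by omega) j (by omega)
  obtain ⟨P, hP0, hPE, hPP⟩ := hGS n le_rfl
  refine ⟨colM fun i => P i, colM_Sp _ ?_, fun g hg => ⟨q g, hqn g hg, ?_⟩⟩
  · intro i j
    rw [hPP i (by omega) j (by omega), eta, Matrix.diagonal_apply]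
    simp only [ε, Fin.ext_iff, Fin.val_zero]
  · ext1 a j
    rw [mul_colM, hPE j (by omega) g hg, Matrix.smul_one_eq_diagonal, Matrix.mul_diagonal]
    rfl
/-! ### The dichotomy -/

theorem two_coe : (2 : Quat) = ((2 : ℝ) : Quat) := by
  have h : (2 : Quat) = 1 + 1 := by norm_num
  have h' : (2 : ℝ) = 1 + 1 := by norm_num
  rw [h, h', Quaternion.coe_add, Quaternion.coe_one]

theorem neg_two_ne : (-2 : Quat) ≠ 0 := by
  rw [two_coe]
  intro h
  have := congrArg (fun q : Quat => q.re) h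
  simp at this

theorem posdef_scalar {n : ℕ} {H G : Set (QM n)} (hc : Ctx n H G)
    (U : Submodule Quatᵐᵒᵖ (QV n)) (hinv : ∀ g ∈ G, ∀ u ∈ U, g *ᵥ u ∈ U)
    (hpos : ∀ u ∈ U, u ≠ 0 → 0 < Qf u) (u : QV n) (hu : u ∈ U) (hu0 : u ≠ 0) :
    ∃ P ∈ Sp n, ∀ g ∈ G, ∃ q : Quat, ‖q‖ = 1 ∧ g * P = P * (q • (1 : QM n)) := by
  obtain ⟨v, hQ, hv⟩ := neg_line hc (all_bounded hc u hu0 (posdef_bounded hc U hinv hpos u hu))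
  exact scalar_form hc v hQ hv

/-- orthogonal complement -/
def perpS {n : ℕ} (W : Submodule Quatᵐᵒᵖ (QV n)) : Submodule Quatᵐᵒᵖ (QV n) where
  carrier := {y | ∀ w ∈ W, hf y w = 0}
  add_mem' := by
    intro a b ha hb w hw
    rw [hf_add_left, ha w hw, hb w hw, add_zero]
  zero_mem' := fun w _ => hf_zero_left w
  smul_mem' := by
    intro c x hx w hw
    have := hf_rs_left x w c.unop
    rw [hx w hw, mul_zero] at this
    exact this

theorem perpS_inv {n : ℕ} {H G : Set (QM n)} (hc : Ctx n H G) (W : Submodule Quatᵐᵒᵖ (QV n))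
    (hW : ∀ g ∈ G, ∀ u ∈ W, g *ᵥ u ∈ W) : ∀ g ∈ G, ∀ u ∈ perpS W, g *ᵥ u ∈ perpS W := by
  intro g hg u hu w hw
  obtain ⟨k, hk, hgk, -⟩ := hc.inv g hg
  have h1 : w = g *ᵥ (k *ᵥ w) := by rw [Matrix.mulVec_mulVec, hgk, Matrix.one_mulVec]
  rw [h1, hf_Sp (hc.subH (hc.GH hg))]
  exact hu _ (hW k hk w hw)

/-- the two-dimensional normal form -/
theorem two_null_form {G : Set (QM 1)} (hsub : G ⊆ Sp 1) (x v : QV 1)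
    (hx : Qf x = 0) (hv : Qf v = 0) (hxv : hf x v = -2)
    (hgx : ∀ g ∈ G, ∃ c, g *ᵥ x = rs x c) (hgv : ∀ g ∈ G, ∃ c, g *ᵥ v = rs v c) :
    ∃ P ∈ Sp 1, ∀ g ∈ G, ∃ q : Quat, ∃ t : ℝ, ‖q‖ = 1 ∧ g * P = P * (q • Bmat 1 t) := by
  have hvx : hf v x = -2 := by
    rw [← hf_star, hxv]; simp
  have hxx : hf x x = 0 := by rw [hf_self, hx]; simp
  have hvv : hf v v = 0 := by rw [hf_self, hv]; simp
  let k : Quat := ((1 / 2 : ℝ) : Quat)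
  have hsk : star k = k := by simp only [k, Quaternion.star_coe]
  let p : Fin 2 → QV 1 := ![rs (x + v) k, rs (x - v) k]
  have hsubl : ∀ a b c : QV 1, hf (a - b) c = hf a c - hf b c := by
    intro a b c
    rw [← hf_star, hf_sub_right, star_sub, hf_star, hf_star]
  refine ⟨colM p, colM_Sp _ ?_, fun g hg => ?_⟩
  · have hkk : k * 2 * k + k * 2 * k = 1 := by
      simp only [k, two_coe, ← Quaternion.coe_mul, ← Quaternion.coe_add]
      norm_num
    have h00 : hf (p 0) (p 0) = -1 := by
      simp only [p, Matrix.cons_val_zero, hf_rs_right, hf_rs_left, hf_add_left, hf_add_right, hxx, hvv, hxv, hvx, hsk]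
      rw [← hkk]; noncomm_ring
    have h11 : hf (p 1) (p 1) = 1 := by
      have hp1 : p 1 = rs (x - v) k := rfl
      simp only [hp1, hf_rs_right, hf_rs_left, hsubl, hf_sub_right, hxx, hvv, hxv, hvx, hsk]
      rw [← hkk]; noncomm_ring
    have h01 : hf (p 0) (p 1) = 0 := by
      simp only [p, Matrix.cons_val_zero, Matrix.cons_val_one, hf_rs_right, hf_rs_left, hf_add_left, hf_sub_right, hxx, hvv, hxv, hvx, hsk]
      noncomm_ring
    have h10 : hf (p 1) (p 0) = 0 := by rw [← hf_star, h01, star_zero]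
    intro i j
    fin_cases i <;> fin_cases j
    · simpa [eta] using h00
    · simpa [eta] using h01
    · simpa [eta] using h10
    · simpa [eta] using h11
  · obtain ⟨α, hα⟩ := hgx g hg
    obtain ⟨β, hβ⟩ := hgv g hg
    have h1 := hf_Sp (hsub hg) x v
    rw [hα, hβ, hf_rs_right, hf_rs_left, hxv] at h1
    have h2 : star α * β = 1 := by
      have h3 : star α * (-2) * β = -2 * (star α * β) := by noncomm_ring
      rw [h3] at h1
      have h4 : (-2 : Quat) * (star α * β) = -2 * 1 := by rw [h1, mul_one]
      exact mul_left_cancel₀ neg_two_ne h4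
    have hα0 : α ≠ 0 := by rintro rfl; simp at h2
    have hpos : 0 < ‖α‖ := norm_pos_iff.2 hα0
    have hβ' : β = (‖α‖⁻¹ ^ 2 : ℝ) • α := by
      have h3 : α * star α * β = α := by rw [mul_assoc, h2, mul_one]
      have h4 := q_star_mul_self (star α)
      rw [star_star, Quaternion.norm_star] at h4
      rw [h4, Quaternion.coe_mul_eq_smul] at h3
      have h5 : (‖α‖⁻¹ ^ 2 : ℝ) • (‖α‖ ^ 2 • β) = (‖α‖⁻¹ ^ 2 : ℝ) • α := by rw [h3]
      rw [smul_smul, ← mul_pow, inv_mul_cancel₀ hpos.ne', one_pow, one_smul] at h5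
      exact h5
    let t := Real.log ‖α‖
    have ht : Real.exp t = ‖α‖ := Real.exp_log hpos
    let q : Quat := ‖α‖⁻¹ • α
    have hqn : ‖q‖ = 1 := by
      simp only [q]
      rw [norm_smul, norm_inv, norm_norm, inv_mul_cancel₀ hpos.ne']
    have hαq : α = (Real.cosh t + Real.sinh t) • q := by
      rw [Real.cosh_add_sinh, ht]
      simp only [q]
      rw [smul_smul, mul_inv_cancel₀ hpos.ne', one_smul]
    have hβq : β = (Real.cosh t - Real.sinh t) • q := by
      rw [Real.cosh_sub_sinh, Real.exp_neg, ht, hβ']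
      simp only [q]
      rw [smul_smul, sq]
    refine ⟨q, t, hqn, ?_⟩
    have hk : ∀ z : Quat, z * k = (1 / 2 : ℝ) • z := by
      intro z
      rw [← Quaternion.coe_commutes, Quaternion.coe_mul_eq_smul]
    have hr : ∀ (z : Quat) (r : ℝ), z * (r : Quat) = r • z := by
      intro z r
      rw [← Quaternion.coe_commutes, Quaternion.coe_mul_eq_smul]
    ext1 a j
    rw [mul_colM, Matrix.mul_apply, Fin.sum_univ_two]
    fin_cases j
    · simp only [p, colM, Fin.zero_eta, Fin.mk_one, Matrix.cons_val_zero, Matrix.cons_val_one, mulVec_rs, Matrix.mulVec_add, hα, hβ, Pi.add_apply, Pi.sub_apply, rs_apply]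
      have b0 : (q • Bmat 1 t) 0 0 = Real.cosh t • q := by rw [← hr]; simp [Bmat]
      have b1 : (q • Bmat 1 t) 1 0 = Real.sinh t • q := by rw [← hr]; simp [Bmat]
      rw [b0, b1, hk, hk, hk, hαq, hβq]
      simp only [mul_smul_comm, smul_mul_assoc, add_mul, sub_mul]
      module
    · simp only [p, colM, Fin.zero_eta, Fin.mk_one, Matrix.cons_val_zero, Matrix.cons_val_one, mulVec_rs, Matrix.mulVec_sub, hα, hβ, Pi.add_apply, Pi.sub_apply, rs_apply]
      have b0 : (q • Bmat 1 t) 0 1 = Real.sinh t • q := by rw [← hr]; simp [Bmat]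
      have b1 : (q • Bmat 1 t) 1 1 = Real.cosh t • q := by rw [← hr]; simp [Bmat]
      rw [b0, b1, hk, hk, hk, hαq, hβq]
      simp only [mul_smul_comm, smul_mul_assoc, add_mul, sub_mul]
      module

theorem dichotomy {n : ℕ} (hn : 1 ≤ n) {H G : Set (QM n)} (hc : Ctx n H G)
    (hG : ¬ ActsHIrreducibly n G) :
    (∃ P ∈ Sp n, ∀ g ∈ G, ∃ q : Quat, ‖q‖ = 1 ∧ g * P = P * (q • (1 : QM n))) ∨
    (n = 1 ∧ ∃ P ∈ Sp n, ∀ g ∈ G, ∃ q : Quat, ∃ t : ℝ, ‖q‖ = 1 ∧ g * P = P * (q • Bmat n t)) := by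
  unfold ActsHIrreducibly at hG
  push Not at hG
  obtain ⟨W, hW, hbot, htop⟩ := hG
  have hWp := perpS_inv hc W hW
  obtain ⟨y', hy'0, hy'⟩ := exists_orth W htop
  by_cases hp1 : ∀ u ∈ W, u ≠ 0 → 0 < Qf u
  · obtain ⟨u, hu, hu0⟩ := (Submodule.ne_bot_iff _).1 hbot
    exact Or.inl (posdef_scalar hc W hW hp1 u hu hu0)
  by_cases hp2 : ∀ u ∈ perpS W, u ≠ 0 → 0 < Qf u
  · exact Or.inl (posdef_scalar hc _ hWp hp2 y' hy' hy'0)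
  push Not at hp1 hp2
  obtain ⟨x, hxW, hx0, hQx⟩ := hp1
  obtain ⟨y, hyW, hy0, hQy⟩ := hp2
  have hyx : hf y x = 0 := hyW x hxW
  have hxy : hf x y = 0 := by rw [← hf_star, hyx, star_zero]
  obtain ⟨h1, h2, -⟩ := key_lemma x y hx0 hQx hxy
  obtain ⟨h3, h4, -⟩ := key_lemma y x hy0 hQy hyx
  have hQx0 : Qf x = 0 := le_antisymm hQx h3
  obtain ⟨c, hxc⟩ := h4 hQx0
  have hxP : x ∈ perpS W := by
    rw [hxc]; exact Submodule.smul_mem _ _ hyW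
  have hgx : ∀ g ∈ G, ∃ c, g *ᵥ x = rs x c := by
    intro g hg
    refine (key_lemma x (g *ᵥ x) hx0 hQx (hxP _ (hW g hg x hxW))).2.1 ?_
    rw [Qf_Sp (hc.subH (hc.GH hg)), hQx0]
  obtain ⟨h, hh, hnot⟩ : ∃ h ∈ H, ¬ ∃ c, h *ᵥ x = rs x c := by
    by_contra hcon
    push Not at hcon
    have htop : Submodule.span Quatᵐᵒᵖ {x} = ⊤ := by
      refine orbit_span hc x hx0 _ fun h hh => ?_
      obtain ⟨c, hc'⟩ := hcon h hh
      rw [hc']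
      exact Submodule.smul_mem _ _ (Submodule.mem_span_singleton_self x)
    have he : (Pi.single 0 1 : QV n) ∈ Submodule.span Quatᵐᵒᵖ {x} := by rw [htop]; trivial
    obtain ⟨a, ha⟩ := Submodule.mem_span_singleton.1 he
    have h5 : Qf (Pi.single 0 1 : QV n) = -1 := by simp [Qf]
    have h6 := Qf_rs x a.unop
    rw [hQx0, mul_zero] at h6
    have h7 : rs x a.unop = Pi.single 0 1 := ha
    rw [h7, h5] at h6
    norm_num at h6
  set v' := h *ᵥ x with hv'
  have hQv' : Qf v' = 0 := by rw [hv', Qf_Sp (hc.subH hh), hQx0]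
  have hs : hf x v' ≠ 0 := fun h0 => hnot ((key_lemma x v' hx0 hQx h0).2.1 hQv')
  have hgv' : ∀ g ∈ G, ∃ c, g *ᵥ v' = rs v' c := by
    intro g hg
    obtain ⟨k, hk, hhk, hkh, hn⟩ := hc.normal h hh
    obtain ⟨c, hc'⟩ := hgx _ (hn g hg)
    refine ⟨c, ?_⟩
    have h1 : g *ᵥ (h *ᵥ x) = h *ᵥ ((k * g * h) *ᵥ x) := by
      rw [Matrix.mulVec_mulVec, Matrix.mulVec_mulVec]
      congr 1
      rw [← mul_assoc, ← mul_assoc, hhk, one_mul]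
    rw [hv', h1, hc', mulVec_rs]
  set d : Quat := (hf x v')⁻¹ * (-2) with hd
  have hd0 : d ≠ 0 := mul_ne_zero (inv_ne_zero hs) neg_two_ne
  set v : QV n := rs v' d with hv
  have hQv : Qf v = 0 := by rw [hv, Qf_rs, hQv', mul_zero]
  have hxv : hf x v = -2 := by rw [hv, hf_rs_right, hd, mul_inv_cancel_left₀ hs]
  have hgv : ∀ g ∈ G, ∃ c, g *ᵥ v = rs v c := by
    intro g hg
    obtain ⟨c, hc'⟩ := hgv' g hg
    refine ⟨d⁻¹ * (c * d), ?_⟩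
    rw [hv, mulVec_rs, hc', rs_rs, rs_rs, mul_inv_cancel_left₀ hd0]
  rcases Nat.lt_or_ge 1 n with hn2 | hn2
  · left
    let V := Submodule.span Quatᵐᵒᵖ (Set.range ![x, v])
    have hVtop : V ≠ ⊤ := span_ne_top (by omega) _
    obtain ⟨z, hz0, hz⟩ := exists_orth V hVtop
    have hxV : x ∈ V := Submodule.subset_span ⟨0, rfl⟩
    have hvV : v ∈ V := Submodule.subset_span ⟨1, rfl⟩
    have hV : ∀ g ∈ G, ∀ u ∈ V, g *ᵥ u ∈ V := by
      intro g hg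
      have : V ≤ V.comap (mvL g) := by
        refine Submodule.span_le.2 ?_
        rintro _ ⟨i, rfl⟩
        fin_cases i
        · obtain ⟨c, hc'⟩ := hgx g hg
          change g *ᵥ x ∈ V
          rw [hc']; exact V.smul_mem _ hxV
        · obtain ⟨c, hc'⟩ := hgv g hg
          change g *ᵥ v ∈ V
          rw [hc']; exact V.smul_mem _ hvV
      exact fun u hu => this hu
    refine posdef_scalar hc (perpS V) (perpS_inv hc V hV) ?_ z hz hz0
    intro u hu hu0
    have hm : Qf (x + v) = -4 := by
      have := Qf_add_rs x v 1
      rw [rs_one, hQx0, hQv, hxv] at this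
      rw [this, two_coe, mul_one, Quaternion.re_neg, Quaternion.re_coe]; norm_num
    have hm0 : x + v ≠ 0 := by intro h0; rw [h0, Qf_zero] at hm; norm_num at hm
    refine (key_lemma (x + v) u hm0 (by linarith) ?_).2.2 (by linarith) hu0
    rw [← hf_star, hu _ (V.add_mem hxV hvV), star_zero]
  · right
    obtain rfl : n = 1 := by omega
    exact ⟨rfl, two_null_form (fun g hg => hc.subH (hc.GH hg)) x v hQx0 hQv hxv hgx hgv⟩
/-! ### The identity component -/

theorem continuous_mulL {n : ℕ} (A : QM n) : Continuous fun X : QM n => A * X :=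
  continuous_const.matrix_mul continuous_id

theorem continuous_mulLR {n : ℕ} (A B : QM n) : Continuous fun X : QM n => A * X * B :=
  (continuous_const.matrix_mul continuous_id).matrix_mul continuous_const

theorem isClosed_Sp (n : ℕ) : IsClosed (Sp n) := by
  refine isClosed_eq ?_ continuous_const
  exact (((continuous_id (X := QM n)).matrix_conjTranspose).matrix_mul continuous_const).matrix_mul continuous_id

theorem component_ctx {n : ℕ} {H : Set (QM n)} (hsub : H ⊆ Sp n) (hone : (1 : QM n) ∈ H)
    (hmul : ∀ A ∈ H, ∀ B ∈ H, A * B ∈ H)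
    (hinv : ∀ A ∈ H, ∃ B ∈ H, A * B = 1 ∧ B * A = 1)
    (hirr : ActsHIrreducibly n H) : Ctx n H (connectedComponentIn H 1) := by
  have hGH : connectedComponentIn H (1 : QM n) ⊆ H := connectedComponentIn_subset _ _
  have h1 : (1 : QM n) ∈ connectedComponentIn H 1 := mem_connectedComponentIn hone
  have hpre : IsPreconnected (connectedComponentIn H (1 : QM n)) := isPreconnected_connectedComponentIn
  refine ⟨hsub, hirr, hGH, h1, ?_, ?_, hmul, ?_⟩
  · intro A hA B hB
    have h2 : (fun X : QM n => A * X) '' connectedComponentIn H 1 ⊆ connectedComponentIn H A := by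
      refine (hpre.image _ (continuous_mulL A).continuousOn).subset_connectedComponentIn
        ⟨1, h1, mul_one A⟩ ?_
      rintro _ ⟨X, hX, rfl⟩
      exact hmul A (hGH hA) X (hGH hX)
    rw [← connectedComponentIn_eq hA] at h2
    exact h2 ⟨B, hB, rfl⟩
  · intro A hA
    obtain ⟨B, hB, hAB, hBA⟩ := hinv A (hGH hA)
    refine ⟨B, ?_, hAB, hBA⟩
    have h2 : (fun X : QM n => B * X) '' connectedComponentIn H 1 ⊆ connectedComponentIn H 1 := by
      refine (hpre.image _ (continuous_mulL B).continuousOn).subset_connectedComponentIn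
        ⟨A, hA, hBA⟩ ?_
      rintro _ ⟨X, hX, rfl⟩
      exact hmul B hB X (hGH hX)
    exact h2 ⟨1, h1, mul_one B⟩
  · intro h hh
    obtain ⟨k, hk, hhk, hkh⟩ := hinv h hh
    refine ⟨k, hk, hhk, hkh, fun g hg => ?_⟩
    have h2 : (fun X : QM n => k * X * h) '' connectedComponentIn H 1 ⊆ connectedComponentIn H 1 := by
      refine (hpre.image _ (continuous_mulLR k h).continuousOn).subset_connectedComponentIn
        ⟨1, h1, by simp only [mul_one]; exact hkh⟩ ?_
      rintro _ ⟨X, hX, rfl⟩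
      exact hmul _ (hmul k hk X (hGH hX)) h hh
    exact h2 ⟨g, hg, rfl⟩

theorem component_closed {n : ℕ} {H : Set (QM n)} (hsub : H ⊆ Sp n) (hone : (1 : QM n) ∈ H)
    (hclosed : IsClosed (Subtype.val ⁻¹' H : Set (Sp n))) :
    IsClosed (connectedComponentIn H (1 : QM n)) := by
  have hH : IsClosed H := by
    have h1 := (isClosed_Sp n).isClosedEmbedding_subtypeVal.isClosedMap _ hclosed
    have h2 : (Subtype.val '' (Subtype.val ⁻¹' H : Set (Sp n)) : Set (QM n)) = H := by
      rw [Subtype.image_preimage_coe]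
      exact Set.inter_eq_right.2 hsub
    rwa [h2] at h1
  refine isClosed_of_closure_subset ?_
  refine isPreconnected_connectedComponentIn.closure.subset_connectedComponentIn
    (subset_closure (mem_connectedComponentIn hone)) ?_
  exact closure_minimal (connectedComponentIn_subset _ _) hH

/-! ### Inverses and scalars in `Sp` -/

theorem eta_sq (n : ℕ) : eta n * eta n = 1 := by
  unfold eta
  rw [Matrix.diagonal_mul_diagonal, ← Matrix.diagonal_one]
  congr 1
  funext i
  split_ifs <;> simp

theorem Sp_inv {n : ℕ} {P : QM n} (hP : P ∈ Sp n) : ∃ R ∈ Sp n, P * R = 1 ∧ R * P = 1 := by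
  have hP' : Pᴴ * eta n * P = eta n := hP
  have h1 : (eta n * Pᴴ * eta n) * P = 1 := by
    rw [mul_assoc, mul_assoc, ← mul_assoc Pᴴ, hP', eta_sq]
  have h2 : P * (eta n * Pᴴ * eta n) = 1 := mul_eq_one_comm.1 h1
  refine ⟨_, ?_, h2, h1⟩
  generalize eta n * Pᴴ * eta n = R at h1 h2
  change Rᴴ * eta n * R = eta n
  calc Rᴴ * eta n * R = Rᴴ * (Pᴴ * eta n * P) * R := by rw [hP']
    _ = (P * R)ᴴ * eta n * (P * R) := by rw [Matrix.conjTranspose_mul]; simp only [mul_assoc]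
    _ = eta n := by rw [h2, Matrix.conjTranspose_one, one_mul, mul_one]

theorem Sp_mul {n : ℕ} {A B : QM n} (hA : A ∈ Sp n) (hB : B ∈ Sp n) : A * B ∈ Sp n := by
  have hA' : Aᴴ * eta n * A = eta n := hA
  have hB' : Bᴴ * eta n * B = eta n := hB
  change (A * B)ᴴ * eta n * (A * B) = eta n
  calc (A * B)ᴴ * eta n * (A * B) = Bᴴ * (Aᴴ * eta n * A) * B := by
        rw [Matrix.conjTranspose_mul]; simp only [mul_assoc]
    _ = eta n := by rw [hA', hB']

theorem scal_Sp {n : ℕ} {u : Quat} (hu : ‖u‖ = 1) : u • (1 : QM n) ∈ Sp n := by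
  change (u • (1 : QM n))ᴴ * eta n * (u • (1 : QM n)) = eta n
  rw [Matrix.smul_one_eq_diagonal, Matrix.diagonal_conjTranspose]
  unfold eta
  rw [Matrix.diagonal_mul_diagonal, Matrix.diagonal_mul_diagonal]
  congr 1
  funext i
  have := q_star_mul u hu
  simp only [Pi.star_apply]
  split_ifs
  · rw [mul_neg, mul_one, neg_mul, this]
  · rw [mul_one, this]

theorem norm_of_scal_Sp {n : ℕ} {u : Quat} (h : u • (1 : QM n) ∈ Sp n) : ‖u‖ = 1 := by
  have h' : (u • (1 : QM n))ᴴ * eta n * (u • (1 : QM n)) = eta n := h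
  rw [Matrix.smul_one_eq_diagonal, Matrix.diagonal_conjTranspose] at h'
  unfold eta at h'
  rw [Matrix.diagonal_mul_diagonal, Matrix.diagonal_mul_diagonal] at h'
  have h2 := congrFun (Matrix.diagonal_injective h') 0
  simp only [Pi.star_apply, if_true, mul_neg, mul_one, neg_mul, neg_inj] at h2
  rw [q_star_mul_self] at h2
  have h3 := congrArg (fun q : Quat => q.re) h2
  simp only [Quaternion.re_coe, Quaternion.re_one] at h3
  nlinarith [norm_nonneg u]

theorem scal_mul {n : ℕ} (p q : Quat) : (p • (1 : QM n)) * (q • (1 : QM n)) = (p * q) • (1 : QM n) := by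
  simp only [Matrix.smul_one_eq_diagonal, Matrix.diagonal_mul_diagonal]

/-! ### Reduction to subgroups of the quaternions -/

theorem reduce {n : ℕ} {H G : Set (QM n)} (hc : Ctx n H G) (hcl : IsClosed G) (hconn : IsPreconnected G)
    (M : Quat → QM n) (L : QM n → Quat) (hL : Continuous L) (hLM : ∀ q, q ≠ 0 → L (M q) = q)
    (hM1 : M 1 = 1) (hMmul : ∀ p q, p ≠ 0 → q ≠ 0 → M (p * q) = M p * M q)
    (hMc : ∀ q, q ≠ 0 → ContinuousAt M q)
    (hMu : ∀ u q : Quat, ‖u‖ = 1 → q ≠ 0 → (u • (1 : QM n)) * M q * (star u • (1 : QM n)) = M (u * q * star u))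
    (P : QM n) (hP : P ∈ Sp n) (hG : ∀ g ∈ G, ∃ q, q ≠ 0 ∧ g * P = P * M q) :
    ∃ T : Set Quat, (T = {1} ∨ T = setU ∨ T = setS ∨ T = setR ∨ T = setRU ∨ T = setRS ∨
      ∃ a b, a ≠ 0 ∧ b ≠ 0 ∧ T = setSp a b) ∧ ConjInSp n G (M '' T) := by
  obtain ⟨R, hR, hPR, hRP⟩ := Sp_inv hP
  have hG' : ∀ g ∈ G, ∃ q, q ≠ 0 ∧ g = P * M q * R := by
    intro g hg
    obtain ⟨q, hq, h⟩ := hG g hg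
    exact ⟨q, hq, by rw [← h, mul_assoc, hPR, mul_one]⟩
  have hRPx : ∀ X : QM n, R * (P * X * R) * P = X := by
    intro X
    calc R * (P * X * R) * P = (R * P) * X * (R * P) := by simp only [mul_assoc]
      _ = X := by rw [hRP, one_mul, mul_one]
  have hPmul : ∀ X Y : QM n, (P * X * R) * (P * Y * R) = P * (X * Y) * R := by
    intro X Y
    calc (P * X * R) * (P * Y * R) = P * X * (R * P) * Y * R := by simp only [mul_assoc]
      _ = P * (X * Y) * R := by rw [hRP, mul_one, mul_assoc P X Y]
  let Gq : Set Quat := {q | q ≠ 0 ∧ P * M q * R ∈ G}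
  have hQG : IsQGroup Gq :=
    { zero_notMem := fun h => h.1 rfl
      one_mem := ⟨one_ne_zero, by rw [hM1, mul_one, hPR]; exact hc.one⟩
      mul_mem := by
        rintro p hp q hq
        refine ⟨mul_ne_zero hp.1 hq.1, ?_⟩
        rw [hMmul p q hp.1 hq.1, ← hPmul]
        exact hc.mul _ hp.2 _ hq.2
      inv_mem := by
        rintro q hq
        have hq0 : q⁻¹ ≠ 0 := inv_ne_zero hq.1
        refine ⟨hq0, ?_⟩
        obtain ⟨B, hB, h1, h2⟩ := hc.inv _ hq.2
        have h3 : (P * M q * R) * (P * M q⁻¹ * R) = 1 := by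
          rw [hPmul, ← hMmul _ _ hq.1 hq0, mul_inv_cancel₀ hq.1, hM1, mul_one, hPR]
        have h4 : B = P * M q⁻¹ * R := left_inv_eq_right_inv h2 h3
        rw [← h4]; exact hB
      closed := by
        intro x hx hx0
        refine ⟨hx0, ?_⟩
        have hct : ContinuousAt (fun q => P * M q * R) x :=
          ContinuousAt.comp (f := M) (g := fun X : QM n => P * X * R)
            (continuous_mulLR P R).continuousAt (hMc x hx0)
        have h1 := hct.continuousWithinAt.mem_closure (s := Gq) (t := G) hx (fun q hq => hq.2)
        rwa [hcl.closure_eq] at h1 }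
  have himg : Gq = (fun g => L (R * g * P)) '' G := by
    ext q
    constructor
    · rintro ⟨hq0, hq⟩
      refine ⟨_, hq, ?_⟩
      simp only []
      rw [hRPx, hLM q hq0]
    · rintro ⟨g, hg, rfl⟩
      obtain ⟨q, hq, rfl⟩ := hG' g hg
      simp only []
      rw [hRPx, hLM q hq]
      exact ⟨hq, hg⟩
  have hpre : IsPreconnected Gq := by
    rw [himg]
    exact hconn.image _ (hL.comp (continuous_mulLR R P)).continuousOn
  obtain ⟨u, hu, T, hT, hcases⟩ := classify hQG hpre
  refine ⟨T, hcases, (u • (1 : QM n)) * R, Sp_mul (scal_Sp hu) hR, P * (star u • (1 : QM n)), ?_, ?_, ?_⟩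
  · calc (u • (1 : QM n)) * R * (P * (star u • (1 : QM n)))
        = (u • (1 : QM n)) * (R * P) * (star u • (1 : QM n)) := by simp only [mul_assoc]
      _ = 1 := by rw [hRP, mul_one, scal_mul, q_mul_star u hu, one_smul]
  · calc P * (star u • (1 : QM n)) * ((u • (1 : QM n)) * R)
        = P * ((star u • (1 : QM n)) * (u • (1 : QM n))) * R := by simp only [mul_assoc]
      _ = 1 := by rw [scal_mul, q_star_mul u hu, one_smul, mul_one, hPR]
  · have hconj : ∀ q, q ≠ 0 → (u • (1 : QM n)) * R * (P * M q * R) * (P * (star u • (1 : QM n)))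
        = M (u * q * star u) := by
      intro q hq
      rw [← hMu u q hu hq]
      calc (u • (1 : QM n)) * R * (P * M q * R) * (P * (star u • (1 : QM n)))
          = (u • (1 : QM n)) * (R * (P * M q * R) * P) * (star u • (1 : QM n)) := by
            simp only [mul_assoc]
        _ = _ := by rw [hRPx]
    rw [hT]
    ext A
    constructor
    · rintro ⟨g, hg, rfl⟩
      obtain ⟨q, hq, rfl⟩ := hG' g hg
      exact ⟨_, ⟨q, ⟨hq, hg⟩, rfl⟩, (hconj q hq).symm⟩
    · rintro ⟨_, ⟨q, ⟨hq, hg⟩, rfl⟩, rfl⟩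
      exact ⟨_, hg, hconj q hq⟩

theorem conj_one {n : ℕ} {G : Set (QM n)} (h : ConjInSp n G {1}) : G = {1} := by
  obtain ⟨P, -, R, hPR, hRP, h⟩ := h
  have key : ∀ A : QM n, P * A * R = 1 ↔ A = 1 := by
    intro A
    constructor
    · intro hA
      calc A = (R * P) * A * (R * P) := by rw [hRP, one_mul, mul_one]
        _ = R * (P * A * R) * P := by simp only [mul_assoc]
        _ = 1 := by rw [hA, mul_one, hRP]
    · rintro rfl
      rw [mul_one, hPR]
  ext A
  constructor
  · intro hA
    have : P * A * R ∈ ({1} : Set (QM n)) := by rw [← h]; exact ⟨A, hA, rfl⟩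
    exact (key A).1 this
  · rintro rfl
    have : (1 : QM n) ∈ (fun A => P * A * R) '' G := by rw [h]; rfl
    obtain ⟨A, hA, hA1⟩ := this
    rw [← (key A).1 hA1]; exact hA

theorem conj_sub_Sp {n : ℕ} {G T : Set (QM n)} (hG : G ⊆ Sp n) (h : ConjInSp n G T) : T ⊆ Sp n := by
  obtain ⟨P, hP, R, hPR, hRP, h⟩ := h
  obtain ⟨R', hR', h1, h2⟩ := Sp_inv hP
  have : R = R' := left_inv_eq_right_inv hRP h1
  subst this
  rw [← h]
  rintro _ ⟨A, hA, rfl⟩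
  exact Sp_mul (Sp_mul hP (hG hA)) hR'
/-! ### Concrete images -/

/-- real coefficients of `B(t)` -/
def bR (t : ℝ) (i j : Fin 2) : ℝ := if i = j then Real.cosh t else Real.sinh t

theorem Bq_apply (q : Quat) (t : ℝ) (i j : Fin 2) : (q • Bmat 1 t) i j = bR t i j • q := by
  have hr : ∀ (z : Quat) (r : ℝ), z * (r : Quat) = r • z := by
    intro z r
    rw [← Quaternion.coe_commutes, Quaternion.coe_mul_eq_smul]
  rw [← hr]
  fin_cases i <;> fin_cases j <;> simp [Bmat, bR]

theorem Bq_mul (p q : Quat) (s t : ℝ) : (p • Bmat 1 s) * (q • Bmat 1 t) = (p * q) • Bmat 1 (s + t) := by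
  ext1 i j
  rw [Matrix.mul_apply, Fin.sum_univ_two, Bq_apply, Bq_apply, Bq_apply, Bq_apply, Bq_apply,
    smul_mul_smul_comm, smul_mul_smul_comm, ← add_smul]
  congr 1
  fin_cases i <;> fin_cases j <;> simp [bR, Real.cosh_add, Real.sinh_add] <;> ring

theorem Bmat_zero : Bmat 1 0 = 1 := by
  have h := Bq_apply 1 0
  ext1 i j
  have := h i j
  rw [one_smul] at this
  rw [this]
  fin_cases i <;> fin_cases j <;> simp [bR]

/-- the parametrization of the subgroup -/
def MB (α : Quat) : QM 1 := (‖α‖⁻¹ • α) • Bmat 1 (Real.log ‖α‖)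

theorem MB_exp (q : Quat) (hq : ‖q‖ = 1) (t : ℝ) : MB (Real.exp t • q) = q • Bmat 1 t := by
  have h1 : ‖Real.exp t • q‖ = Real.exp t := by
    rw [norm_smul, hq, mul_one, Real.norm_eq_abs, abs_of_pos (Real.exp_pos t)]
  unfold MB
  rw [h1, Real.log_exp, smul_smul, inv_mul_cancel₀ (Real.exp_pos t).ne', one_smul]

theorem MB_unit (q : Quat) (hq : ‖q‖ = 1) : MB q = q • (1 : QM 1) := by
  have := MB_exp q hq 0
  rwa [Real.exp_zero, one_smul, Bmat_zero] at this

theorem MB_mul (p q : Quat) (hp : p ≠ 0) (hq : q ≠ 0) : MB (p * q) = MB p * MB q := by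
  unfold MB
  rw [Bq_mul, norm_mul, Real.log_mul (norm_ne_zero_iff.2 hp) (norm_ne_zero_iff.2 hq),
    smul_mul_smul_comm, mul_inv]

theorem MB_cont (q : Quat) (hq : q ≠ 0) : ContinuousAt MB q := by
  refine continuousAt_pi.2 fun i => continuousAt_pi.2 fun j => ?_
  have h1 : (fun α : Quat => MB α i j) = fun α => bR (Real.log ‖α‖) i j • (‖α‖⁻¹ • α) := by
    funext α
    exact Bq_apply _ _ i j
  rw [h1]
  have hb : Continuous fun t => bR t i j := by
    unfold bR
    split_ifs
    · exact Real.continuous_cosh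
    · exact Real.continuous_sinh
  have hn : ‖q‖ ≠ 0 := norm_ne_zero_iff.2 hq
  have hl : ContinuousAt (fun α : Quat => Real.log ‖α‖) q := continuous_norm.continuousAt.log hn
  have hi : ContinuousAt (fun α : Quat => ‖α‖⁻¹) q := continuous_norm.continuousAt.inv₀ hn
  exact (ContinuousAt.comp (f := fun α : Quat => Real.log ‖α‖) hb.continuousAt hl).smul (hi.smul continuousAt_id)

theorem MB_conj (u q : Quat) (hu : ‖u‖ = 1) :
    (u • (1 : QM 1)) * MB q * (star u • (1 : QM 1)) = MB (u * q * star u) := by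
  have hn : ‖u * q * star u‖ = ‖q‖ := by
    rw [norm_mul, norm_mul, Quaternion.norm_star, hu, one_mul, mul_one]
  unfold MB
  rw [hn, Matrix.smul_one_eq_diagonal, Matrix.smul_one_eq_diagonal]
  ext1 i j
  rw [Matrix.mul_diagonal, Matrix.diagonal_mul, Bq_apply, Bq_apply]
  simp only [mul_smul_comm, smul_mul_assoc]

theorem MB_left (q : Quat) (hq : q ≠ 0) : MB q 0 0 + MB q 0 1 = q := by
  unfold MB
  rw [Bq_apply, Bq_apply, ← add_smul]
  simp only [bR, if_true]
  rw [if_neg (by decide), Real.cosh_add_sinh, Real.exp_log (norm_pos_iff.2 hq), smul_smul,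
    mul_inv_cancel₀ (norm_ne_zero_iff.2 hq), one_smul]

theorem cis_eq (x : ℝ) : (((Real.cos x : ℝ) : Quat) + ((Real.sin x : ℝ) : Quat) * qi)
    = mk4 (Real.cos x) (Real.sin x) 0 0 := by
  have hq : qi = mk4 0 1 0 0 := rfl
  rw [hq, Quaternion.coe_mul_eq_smul]
  ext <;> simp

theorem image_U (n : ℕ) : (fun q : Quat => q • (1 : QM n)) '' setU = U1One n := by
  ext A
  constructor
  · rintro ⟨l, ⟨h1, h2, h3⟩, rfl⟩
    exact ⟨l, h1, h2, h3, rfl⟩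
  · rintro ⟨l, h1, h2, h3, rfl⟩
    exact ⟨l, ⟨h1, h2, h3⟩, rfl⟩

theorem image_S (n : ℕ) : (fun q : Quat => q • (1 : QM n)) '' setS = Sp1One n := by
  ext A
  constructor
  · rintro ⟨l, h3, rfl⟩
    exact ⟨l, h3, rfl⟩
  · rintro ⟨l, h3, rfl⟩
    exact ⟨l, h3, rfl⟩

theorem imageB_U : MB '' setU = U1One 1 := by
  rw [← image_U]
  exact Set.image_congr fun q hq => MB_unit q hq.2.2

theorem imageB_S : MB '' setS = Sp1One 1 := by
  rw [← image_S]
  exact Set.image_congr fun q hq => MB_unit q hq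

theorem imageB_R : MB '' setR = SOo11 1 := by
  ext A
  constructor
  · rintro ⟨_, ⟨t, rfl⟩, rfl⟩
    exact ⟨t, by rw [MB_exp 1 norm_one, one_smul]⟩
  · rintro ⟨t, rfl⟩
    exact ⟨_, ⟨t, rfl⟩, by rw [MB_exp 1 norm_one, one_smul]⟩

theorem imageB_RU : MB '' setRU = SOo11U1 1 := by
  ext A
  constructor
  · rintro ⟨_, ⟨t, l, ⟨h1, h2, h3⟩, rfl⟩, rfl⟩
    exact ⟨t, l, h1, h2, h3, MB_exp l h3 t⟩
  · rintro ⟨t, l, h1, h2, h3, rfl⟩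
    exact ⟨_, ⟨t, l, ⟨h1, h2, h3⟩, rfl⟩, MB_exp l h3 t⟩

theorem imageB_RS : MB '' setRS = SOo11Sp1 1 := by
  ext A
  constructor
  · rintro ⟨_, ⟨t, l, h3, rfl⟩, rfl⟩
    exact ⟨t, l, h3, MB_exp l h3 t⟩
  · rintro ⟨t, l, h3, rfl⟩
    exact ⟨_, ⟨t, l, h3, rfl⟩, MB_exp l h3 t⟩

theorem imageB_Sp (a b : ℝ) : MB '' setSp a b = Sab 1 a b := by
  ext A
  constructor
  · rintro ⟨_, ⟨t, rfl⟩, rfl⟩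
    exact ⟨t, by rw [cis_eq, MB_exp _ (norm_cis _)]⟩
  · rintro ⟨t, rfl⟩
    exact ⟨_, ⟨t, rfl⟩, by rw [cis_eq, MB_exp _ (norm_cis _)]⟩

theorem norm_exp_smul_ne (l : Quat) (hl : ‖l‖ = 1) : ‖Real.exp 1 • l‖ ≠ 1 := by
  rw [norm_smul, hl, mul_one, Real.norm_eq_abs, abs_of_pos (Real.exp_pos 1)]
  have := Real.add_one_lt_exp (one_ne_zero)
  linarith

theorem caseA {n : ℕ} {H G : Set (QM n)} (hc : Ctx n H G) (hcl : IsClosed G) (hconn : IsPreconnected G)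
    (P : QM n) (hP : P ∈ Sp n) (hG : ∀ g ∈ G, ∃ q : Quat, ‖q‖ = 1 ∧ g * P = P * (q • (1 : QM n))) :
    G = {1} ∨ ConjInSp n G (U1One n) ∨ ConjInSp n G (Sp1One n) := by
  have hcont : Continuous fun q : Quat => q • (1 : QM n) := continuous_id.smul continuous_const
  obtain ⟨T, hT, hconj⟩ := reduce hc hcl hconn (fun q => q • (1 : QM n)) (fun A => A 0 0)
    ((continuous_apply 0).comp (continuous_apply 0)) (fun q _ => by simp) (one_smul _ _)
    (fun p q _ _ => (scal_mul p q).symm) (fun q _ => hcont.continuousAt)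
    (fun u q _ _ => by rw [scal_mul, scal_mul]) P hP
    (fun g hg => by
      obtain ⟨q, hq, h⟩ := hG g hg
      refine ⟨q, ?_, h⟩
      rintro rfl
      rw [norm_zero] at hq
      exact zero_ne_one hq)
  have hnorm : ∀ q ∈ T, ‖q‖ = 1 := fun q hq =>
    norm_of_scal_Sp (conj_sub_Sp (fun g hg => hc.subH (hc.GH hg)) hconj ⟨q, hq, rfl⟩)
  rcases hT with rfl | rfl | rfl | rfl | rfl | rfl | ⟨a, b, ha, hb, rfl⟩
  · left
    apply conj_one
    rwa [Set.image_singleton, one_smul] at hconj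
  · right; left
    rwa [image_U] at hconj
  · right; right
    rwa [image_S] at hconj
  · exact absurd (hnorm _ ⟨1, rfl⟩) (norm_exp_smul_ne 1 norm_one)
  · exact absurd (hnorm _ ⟨1, 1, ⟨rfl, rfl, norm_one⟩, rfl⟩) (norm_exp_smul_ne 1 norm_one)
  · exact absurd (hnorm _ ⟨1, 1, norm_one, rfl⟩) (norm_exp_smul_ne 1 norm_one)
  · have h1 := hnorm _ ⟨a⁻¹, rfl⟩
    rw [mul_inv_cancel₀ ha] at h1
    exact absurd h1 (norm_exp_smul_ne _ (norm_cis _))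

theorem caseB {H G : Set (QM 1)} (hc : Ctx 1 H G) (hcl : IsClosed G) (hconn : IsPreconnected G)
    (P : QM 1) (hP : P ∈ Sp 1)
    (hG : ∀ g ∈ G, ∃ q : Quat, ∃ t : ℝ, ‖q‖ = 1 ∧ g * P = P * (q • Bmat 1 t)) :
    G = {1} ∨ ConjInSp 1 G (U1One 1) ∨ ConjInSp 1 G (Sp1One 1) ∨ ConjInSp 1 G (SOo11 1) ∨
      ConjInSp 1 G (SOo11U1 1) ∨ ConjInSp 1 G (SOo11Sp1 1) ∨
      ∃ a b : ℝ, a ≠ 0 ∧ b ≠ 0 ∧ ConjInSp 1 G (Sab 1 a b) := by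
  have hM1 : MB 1 = 1 := by rw [MB_unit 1 norm_one, one_smul]
  have hLc : Continuous fun A : QM 1 => A 0 0 + A 0 1 :=
    (continuous_id.matrix_elem 0 0).add (continuous_id.matrix_elem 0 1)
  obtain ⟨T, hT, hconj⟩ := reduce hc hcl hconn MB (fun A => A 0 0 + A 0 1) hLc MB_left hM1
    MB_mul MB_cont (fun u q hu _ => MB_conj u q hu) P hP
    (fun g hg => by
      obtain ⟨q, t, hq, h⟩ := hG g hg
      refine ⟨Real.exp t • q, ?_, by rw [MB_exp q hq, h]⟩
      refine smul_ne_zero (Real.exp_pos t).ne' ?_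
      rintro rfl
      rw [norm_zero] at hq
      exact zero_ne_one hq)
  rcases hT with rfl | rfl | rfl | rfl | rfl | rfl | ⟨a, b, ha, hb, rfl⟩
  · left
    apply conj_one
    rwa [Set.image_singleton, hM1] at hconj
  · rw [imageB_U] at hconj
    exact Or.inr (Or.inl hconj)
  · rw [imageB_S] at hconj
    exact Or.inr (Or.inr (Or.inl hconj))
  · rw [imageB_R] at hconj
    exact Or.inr (Or.inr (Or.inr (Or.inl hconj)))
  · rw [imageB_RU] at hconj
    exact Or.inr (Or.inr (Or.inr (Or.inr (Or.inl hconj))))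
  · rw [imageB_RS] at hconj
    exact Or.inr (Or.inr (Or.inr (Or.inr (Or.inr (Or.inl hconj)))))
  · rw [imageB_Sp] at hconj
    exact Or.inr (Or.inr (Or.inr (Or.inr (Or.inr (Or.inr ⟨a, b, ha, hb, hconj⟩)))))

theorem identity_component_of_Hirreducible_subgroup
    (n : ℕ) (hn : 1 ≤ n) (H : Set (Matrix (Fin (n + 1)) (Fin (n + 1)) Quat))
    (hsub : H ⊆ Sp n)
    (hone : (1 : Matrix (Fin (n + 1)) (Fin (n + 1)) Quat) ∈ H)
    (hmul : ∀ A ∈ H, ∀ B ∈ H, A * B ∈ H)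
    (hinv : ∀ A ∈ H, ∃ B ∈ H, A * B = 1 ∧ B * A = 1)
    (hclosed : IsClosed (Subtype.val ⁻¹' H : Set (Sp n)))
    (hirr : ActsHIrreducibly n H) :
    -- (i) H⁰ is trivial, i.e. H is discrete
    connectedComponentIn H 1 = {1} ∨
    -- (ii) H⁰ is conjugate to U(1)·𝟙 or Sp(1)·𝟙
    (ConjInSp n (connectedComponentIn H 1) (U1One n) ∨
     ConjInSp n (connectedComponentIn H 1) (Sp1One n)) ∨
    -- (iii) H⁰ acts ℍ-irreducibly
    ActsHIrreducibly n (connectedComponentIn H 1) ∨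
    -- (iv) n = 1 and H⁰ is conjugate to one of the listed groups
    (n = 1 ∧
      (ConjInSp n (connectedComponentIn H 1) (SOo11 n) ∨
       ConjInSp n (connectedComponentIn H 1) (SOo11U1 n) ∨
       ConjInSp n (connectedComponentIn H 1) (SOo11Sp1 n) ∨
       ∃ a b : ℝ, a ≠ 0 ∧ b ≠ 0 ∧ ConjInSp n (connectedComponentIn H 1) (Sab n a b))) := by
  have hctx := component_ctx hsub hone hmul hinv hirr
  have hcl := component_closed hsub hone hclosed
  have hconn : IsPreconnected (connectedComponentIn H (1 : QM n)) := isPreconnected_connectedComponentIn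
  by_cases hG : ActsHIrreducibly n (connectedComponentIn H 1)
  · exact Or.inr (Or.inr (Or.inl hG))
  rcases dichotomy hn hctx hG with ⟨P, hP, h⟩ | ⟨h1, P, hP, h⟩
  · rcases caseA hctx hcl hconn P hP h with h | h
    · exact Or.inl h
    · exact Or.inr (Or.inl h)
  · subst h1
    rcases caseB hctx hcl hconn P hP h with h | h | h | h
    · exact Or.inl h
    · exact Or.inr (Or.inl (Or.inl h))
    · exact Or.inr (Or.inl (Or.inr h))
    · exact Or.inr (Or.inr (Or.inr ⟨rfl, h⟩))
end
end

section
/- The group U⁰ := {A ∈ Sp(1,1) : AΦ = ΦA}, with the subspace topology from Mat₂(ℍ), is path-connected and simply connected. -/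
open Quaternion Matrix

noncomputable section

/-- The matrix η = diag(-1,1). -/
def eta2 : Matrix (Fin 2) (Fin 2) Quat := Matrix.diagonal ![-1, 1]

/-- Sp(1,1) as a set of quaternionic matrices. -/
def Sp11 : Set (Matrix (Fin 2) (Fin 2) Quat) :=
  {A | Aᴴ * eta2 * A = eta2}

/-- The matrix Φ = [[0,-1],[1,0]]. -/
def Phi : Matrix (Fin 2) (Fin 2) Quat := !![0, -1; 1, 0]

/-- The group U⁰ = {A ∈ Sp(1,1) : AΦ = ΦA}. -/
def U0 : Set (Matrix (Fin 2) (Fin 2) Quat) :=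
  {A ∈ Sp11 | A * Phi = Phi * A}

theorem slit_simply {E : Type*} [NormedAddCommGroup E] [NormedSpace ℝ E] (v : E) (hv : v ≠ 0) :
    IsSimplyConnected {z : E | ∀ s : ℝ, 0 ≤ s → z ≠ s • v} := by
  have hstar : StarConvex ℝ (-v) {z : E | ∀ s : ℝ, 0 ≤ s → z ≠ s • v} := by
    intro z hz a b ha hb hab s hs h
    rcases hb.eq_or_lt with h0 | h0
    · subst h0
      have ha1 : a = 1 := by linarith
      subst ha1
      have : (s + 1) • v = 0 := by
        rw [add_smul, ← h]; simp
      rcases smul_eq_zero.1 this with h1 | h1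
      · linarith
      · exact hv h1
    · apply hz ((s + a) / b) (by positivity)
      have h2 : b • z = (s + a) • v := by
        rw [add_smul, ← h]; simp
      rw [div_eq_inv_mul, mul_smul, ← h2, smul_smul, inv_mul_cancel₀ h0.ne', one_smul]
  have hne : ({z : E | ∀ s : ℝ, 0 ≤ s → z ≠ s • v}).Nonempty := by
    refine ⟨-v, fun s hs h => ?_⟩
    have : (s + 1) • v = 0 := by
      rw [add_smul, ← h]; simp
    rcases smul_eq_zero.1 this with h1 | h1
    · linarith
    · exact hv h1
  have := hstar.contractibleSpace hne
  unfold IsSimplyConnected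
  infer_instance

theorem compl_zero_simply {E : Type*} [NormedAddCommGroup E] [NormedSpace ℝ E]
    [FiniteDimensional ℝ E] (hE : 2 < Module.finrank ℝ E) :
    IsSimplyConnected ({0}ᶜ : Set E) := by
  rw [isSimplyConnected_iff_exists_homotopy_refl_forall_mem]
  refine ⟨isPathConnected_compl_singleton_of_one_lt_rank ?_ 0, ?_⟩
  · rw [← Module.finrank_eq_rank]
    exact_mod_cast (by omega : 1 < Module.finrank ℝ E)
  intro x p hp
  -- lower bound
  obtain ⟨δ, hδ, hδp⟩ : ∃ δ : ℝ, 0 < δ ∧ ∀ t, δ ≤ ‖p t‖ := by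
    obtain ⟨t0, -, ht0⟩ := isCompact_univ.exists_isMinOn (s := (Set.univ : Set unitInterval))
      ⟨0, trivial⟩ (f := fun t => ‖p t‖) (by fun_prop)
    exact ⟨‖p t0‖, norm_pos_iff.2 (hp t0), fun t => ht0 (Set.mem_univ t)⟩
  obtain ⟨g, hg, hgd, -⟩ := p.continuous_extend.exists_contDiff_approx 1
    (ε := fun _ => δ / 4) (by fun_prop) (fun _ => by positivity)
  let q : ℝ → E := fun t => g t + ((1 - t) • (x - g 0) + t • (x - g 1))
  have hq : ContDiff ℝ 1 q := by
    have : ContDiff ℝ 1 g := hg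
    fun_prop
  have hqp : ∀ t : unitInterval, ‖q t - p t‖ < δ := by
    intro t
    have h0 := hgd 0
    have h1 := hgd 1
    have h2 := hgd t
    rw [dist_eq_norm] at h0 h1 h2
    simp only [Path.extend_zero, Path.extend_one, Path.extend_apply, t.2, Subtype.coe_eta] at h0 h1 h2
    rw [norm_sub_rev] at h0 h1
    have e : q t - p t = (g t - p t) + ((1 - (t:ℝ)) • (x - g 0) + (t:ℝ) • (x - g 1)) := by
      simp only [q]; abel
    have n1 : ‖(1 - (t:ℝ)) • (x - g 0)‖ ≤ (1 - t) * (δ/4) := by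
      rw [norm_smul, Real.norm_of_nonneg (by linarith [t.2.2])]
      exact mul_le_mul_of_nonneg_left h0.le (by linarith [t.2.2])
    have n2 : ‖(t:ℝ) • (x - g 1)‖ ≤ t * (δ/4) := by
      rw [norm_smul, Real.norm_of_nonneg t.2.1]
      exact mul_le_mul_of_nonneg_left h1.le t.2.1
    rw [e]
    have := norm_add_le (g t - p t) ((1 - (t:ℝ)) • (x - g 0) + (t:ℝ) • (x - g 1))
    have := norm_add_le ((1 - (t:ℝ)) • (x - g 0)) ((t:ℝ) • (x - g 1))
    nlinarith
  let Q : Path x x :=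
    { toFun := fun t => q t
      continuous_toFun := hq.continuous.comp continuous_subtype_val
      source' := by simp [q]
      target' := by simp [q] }
  have hQ : ∀ t, Q t = q t := fun t => rfl
  -- affine homotopy
  let F1 : p.Homotopy Q :=
    { toFun := fun z => (1 - (z.1 : ℝ)) • p z.2 + (z.1 : ℝ) • Q z.2
      continuous_toFun := by fun_prop
      map_zero_left := by simp
      map_one_left := by simp
      prop' := by
        intro t y hy
        rcases hy with rfl | rfl <;> simp [← add_smul] }
  have hF1 : ∀ z, F1 z ∈ ({0}ᶜ : Set E) := by
    intro z hz
    have hz' : (1 - (z.1 : ℝ)) • p z.2 + (z.1 : ℝ) • Q z.2 = 0 := hz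
    have h1 : p z.2 = -((z.1 : ℝ) • (q z.2 - p z.2)) := by
      rw [hQ] at hz'
      have : p z.2 + (z.1 : ℝ) • (q z.2 - p z.2) = 0 := by
        rw [← hz']; module
      exact eq_neg_of_add_eq_zero_left this
    have h2 := hqp z.2
    have h3 := hδp z.2
    rw [h1, norm_neg, norm_smul, Real.norm_of_nonneg z.1.2.1] at h3
    have := mul_le_mul_of_nonneg_right z.1.2.2 (norm_nonneg (q z.2 - p z.2))
    linarith
  -- avoid a ray
  have hdense : Dense (Set.range (fun z : ℝ × ℝ => z.1 • q z.2))ᶜ := by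
    apply ContDiff.dense_compl_range_of_finrank_lt_finrank
    · fun_prop
    · simpa using hE
  obtain ⟨v, hv⟩ := hdense.nonempty
  have hv0 : v ≠ 0 := by
    rintro rfl
    exact hv ⟨(0, 0), by simp⟩
  have hslit := (isSimplyConnected_iff_exists_homotopy_refl_forall_mem.1 (slit_simply v hv0)).2
  have hqne : ∀ t, Q t ≠ 0 := by
    intro t
    have := hF1 (1, t)
    simpa [F1] using this
  obtain ⟨F2, hF2⟩ := hslit x Q (by
    intro t s hs h
    rcases hs.eq_or_lt with h0 | h0
    · subst h0
      exact hqne t (by simpa using h)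
    · exact hv ⟨(s⁻¹, t), by
        show s⁻¹ • q t = v
        rw [← hQ, h, smul_smul, inv_mul_cancel₀ h0.ne', one_smul]⟩)
  refine ⟨F1.trans F2, fun z => ?_⟩
  rw [Path.Homotopy.trans_apply]
  split_ifs
  · exact hF1 _
  · intro h0
    exact hF2 _ 0 le_rfl (by simpa using h0)

theorem simply_prod {X Y : Type*} [TopologicalSpace X] [TopologicalSpace Y]
    [SimplyConnectedSpace X] [SimplyConnectedSpace Y] : SimplyConnectedSpace (X × Y) := by
  rw [simply_connected_iff_loops_nullhomotopic]
  refine ⟨inferInstance, ?_⟩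
  rintro ⟨x, y⟩ γ
  obtain ⟨F⟩ := SimplyConnectedSpace.paths_homotopic (γ.map continuous_fst) (Path.refl x)
  obtain ⟨G⟩ := SimplyConnectedSpace.paths_homotopic (γ.map continuous_snd) (Path.refl y)
  exact ⟨(Path.Homotopic.prodHomotopy F G).cast (by ext <;> rfl) (by ext <;> rfl)⟩

theorem simply_retract {X Y : Type*} [TopologicalSpace X] [TopologicalSpace Y]
    [SimplyConnectedSpace Y] (i : C(X, Y)) (r : C(Y, X)) (h : ∀ x, r (i x) = x) :
    SimplyConnectedSpace X := by
  rw [simply_connected_iff_loops_nullhomotopic]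
  constructor
  · have hs : Function.Surjective r := fun x => ⟨i x, h x⟩
    exact hs.pathConnectedSpace r.continuous
  · intro x γ
    obtain ⟨F⟩ := SimplyConnectedSpace.paths_homotopic (γ.map i.continuous) (Path.refl (i x))
    exact ⟨((F.map r).pathCast (h x).symm (h x).symm).cast (by ext; simp [h]) (by ext; simp [h])⟩

theorem mem_U0_iff (A : Matrix (Fin 2) (Fin 2) Quat) :
    A ∈ U0 ↔ A 0 0 = A 1 1 ∧ A 0 1 = - A 1 0 ∧ ‖A 0 0‖ ^ 2 = 1 + ‖A 1 0‖ ^ 2 ∧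
      star (A 0 0) * A 1 0 + star (A 1 0) * A 0 0 = 0 := by
  have key : ∀ a : Quat, star a * a = ((‖a‖ ^ 2 : ℝ) : Quat) := by
    intro a
    rw [Quaternion.star_mul_self, Quaternion.normSq_eq_norm_mul_self, sq]
  have h1 : A * Phi = Phi * A ↔ A 0 0 = A 1 1 ∧ A 0 1 = - A 1 0 := by
    rw [← Matrix.ext_iff]
    simp [Phi, Matrix.mul_apply, Fin.forall_fin_two, Fin.sum_univ_two]
    constructor
    · rintro ⟨⟨h1, h2⟩, h3, h4⟩
      exact ⟨h3.symm, h1⟩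
    · rintro ⟨h1, h2⟩
      simp [h1, h2]
  have h2 : A 0 0 = A 1 1 → A 0 1 = - A 1 0 → (A ∈ Sp11 ↔ ‖A 0 0‖ ^ 2 = 1 + ‖A 1 0‖ ^ 2 ∧
      star (A 0 0) * A 1 0 + star (A 1 0) * A 0 0 = 0) := by
    intro e1 e2
    have : A ∈ Sp11 ↔ Aᴴ * eta2 * A = eta2 := Iff.rfl
    rw [this, ← Matrix.ext_iff]
    have hre : ‖A 0 0‖ ^ 2 = 1 + ‖A 1 0‖ ^ 2 ↔
        ((‖A 0 0‖ ^ 2 : ℝ) : Quat) = 1 + ((‖A 1 0‖ ^ 2 : ℝ) : Quat) := by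
      rw [← Quaternion.coe_one, ← Quaternion.coe_add, Quaternion.coe_inj]
    rw [hre, ← key, ← key]
    simp [eta2, Matrix.mul_apply, Fin.forall_fin_two, Fin.sum_univ_two, ← e1, e2,
      Matrix.diagonal]
    constructor
    · rintro ⟨⟨h1, h2⟩, h3, h4⟩
      exact ⟨by rw [← h4]; abel, h2⟩
    · rintro ⟨h1, h2⟩
      rw [h1]
      exact ⟨⟨by abel, h2⟩, by rw [← h2]; abel, by abel⟩
  unfold U0
  constructor
  · rintro ⟨h, h'⟩
    obtain ⟨e1, e2⟩ := h1.1 h'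
    exact ⟨e1, e2, (h2 e1 e2).1 h⟩
  · rintro ⟨e1, e2, h⟩
    exact ⟨(h2 e1 e2).2 h, h1.2 ⟨e1, e2⟩⟩

theorem U0_ne (A : U0) : A.1 0 0 ≠ 0 := by
  intro h
  have := ((mem_U0_iff A.1).1 A.2).2.2.1
  rw [h] at this
  simp at this
  nlinarith [sq_nonneg ‖A.1 1 0‖]

def U0inc : C(U0, ({0}ᶜ : Set Quat) × Quat) where
  toFun A := (⟨A.1 0 0, U0_ne A⟩, ‖A.1 0 0‖⁻¹ • (star (A.1 0 0) * A.1 1 0))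
  continuous_toFun := by
    have h0 : Continuous fun A : U0 => A.1 0 0 :=
      continuous_subtype_val.matrix_elem 0 0
    have h1 : Continuous fun A : U0 => A.1 1 0 :=
      continuous_subtype_val.matrix_elem 1 0
    refine (h0.subtype_mk _).prodMk ?_
    exact (h0.norm.inv₀ fun A => norm_ne_zero_iff.2 (U0_ne A)).smul (h0.star.mul h1)

def antiPart (y : Quat) : Quat := (2⁻¹ : ℝ) • (y - star y)

theorem star_antiPart (y : Quat) : star (antiPart y) = - antiPart y := by
  simp only [antiPart, Quaternion.star_smul, star_sub, star_star, ← smul_neg, neg_sub]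

theorem continuous_antiPart : Continuous antiPart := by
  unfold antiPart
  fun_prop

def U0mat (a y : Quat) : Matrix (Fin 2) (Fin 2) Quat :=
  !![√(1 + ‖antiPart y‖ ^ 2) • ‖a‖⁻¹ • a, -((‖a‖⁻¹ • a) * antiPart y);
    (‖a‖⁻¹ • a) * antiPart y, √(1 + ‖antiPart y‖ ^ 2) • ‖a‖⁻¹ • a]

theorem U0mat_mem (a y : Quat) (ha : a ≠ 0) : U0mat a y ∈ U0 := by
  have hn : ‖‖a‖⁻¹ • a‖ = 1 := norm_smul_inv_norm (𝕜 := ℝ) ha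
  rw [mem_U0_iff]
  have hu : star (‖a‖⁻¹ • a) * (‖a‖⁻¹ • a) = 1 := by
    rw [Quaternion.star_mul_self, Quaternion.normSq_eq_norm_mul_self, hn]; simp
  have hp := star_antiPart y
  unfold U0mat
  generalize ‖a‖⁻¹ • a = u at *
  generalize antiPart y = p at *
  refine ⟨by simp, by simp, ?_, ?_⟩
  · simp [norm_smul, hn]
    rw [Real.sq_sqrt (by positivity)]
  · simp only [Matrix.of_apply, Matrix.cons_val', Matrix.cons_val_zero, Matrix.cons_val_one,
      Matrix.cons_val_fin_one, Quaternion.star_smul, star_mul, hp, smul_mul_assoc,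
      mul_smul_comm]
    rw [← mul_assoc, hu, mul_assoc, hu]
    simp

def U0ret : C(({0}ᶜ : Set Quat) × Quat, U0) where
  toFun z := ⟨U0mat z.1.1 z.2, U0mat_mem _ _ z.1.2⟩
  continuous_toFun := by
    refine Continuous.subtype_mk ?_ _
    have h0 : Continuous fun z : ({0}ᶜ : Set Quat) × Quat => z.1.1 := by fun_prop
    have h1 : Continuous fun z : ({0}ᶜ : Set Quat) × Quat => antiPart z.2 :=
      continuous_antiPart.comp continuous_snd
    have hu : Continuous fun z : ({0}ᶜ : Set Quat) × Quat => ‖z.1.1‖⁻¹ • z.1.1 :=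
      (h0.norm.inv₀ fun z => norm_ne_zero_iff.2 z.1.2).smul h0
    have hs : Continuous fun z : ({0}ᶜ : Set Quat) × Quat => √(1 + ‖antiPart z.2‖ ^ 2) := by
      fun_prop
    refine continuous_matrix fun i j => ?_
    fin_cases i <;> fin_cases j
    · exact hs.smul hu
    · exact (hu.mul h1).neg
    · exact hu.mul h1
    · exact hs.smul hu

theorem U0ret_inc (A : U0) : U0ret (U0inc A) = A := by
  obtain ⟨e1, e2, e3, e4⟩ := (mem_U0_iff A.1).1 A.2
  have hne := U0_ne A
  apply Subtype.ext
  show U0mat (A.1 0 0) (‖A.1 0 0‖⁻¹ • (star (A.1 0 0) * A.1 1 0)) = A.1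
  generalize ha : A.1 0 0 = a at *
  generalize hc : A.1 1 0 = c at *
  have hna : ‖a‖ ≠ 0 := norm_ne_zero_iff.2 hne
  have hy : antiPart (‖a‖⁻¹ • (star a * c)) = ‖a‖⁻¹ • (star a * c) := by
    have : star (star a * c) = - (star a * c) := by
      rw [star_mul, star_star]
      exact eq_neg_of_add_eq_zero_right e4
    unfold antiPart
    rw [Quaternion.star_smul, this]
    module
  have hny : ‖‖a‖⁻¹ • (star a * c)‖ = ‖c‖ := by
    rw [norm_smul, norm_mul, Quaternion.norm_star, norm_inv, norm_norm]
    field_simp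
  have hs : √(1 + ‖c‖ ^ 2) = ‖a‖ := by
    rw [← e3, Real.sqrt_sq (norm_nonneg _)]
  have hd : ‖a‖ • ‖a‖⁻¹ • a = a := by
    rw [smul_smul, mul_inv_cancel₀ hna, one_smul]
  have hm : (‖a‖⁻¹ • a) * (‖a‖⁻¹ • (star a * c)) = c := by
    rw [smul_mul_assoc, mul_smul_comm, ← mul_assoc, Quaternion.self_mul_star,
      Quaternion.normSq_eq_norm_mul_self, Quaternion.coe_mul_eq_smul, smul_smul, smul_smul]
    rw [show ‖a‖⁻¹ * ‖a‖⁻¹ * (‖a‖ * ‖a‖) = 1 by field_simp, one_smul]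
  unfold U0mat
  rw [hy, hny, hs, hd, hm]
  ext1 i j
  fin_cases i <;> fin_cases j
  · simp [ha]
  · simp [e2]
  · simp [hc]
  · simp [e1]

theorem U0_pathConnected_and_simplyConnected :
    IsPathConnected U0 ∧ SimplyConnectedSpace U0 := by
  have h1 : IsSimplyConnected ({0}ᶜ : Set Quat) :=
    compl_zero_simply (by rw [Quaternion.finrank_eq_four]; norm_num)
  have := h1.simplyConnectedSpace
  have h2 : SimplyConnectedSpace (({0}ᶜ : Set Quat) × Quat) := simply_prod
  have h3 : SimplyConnectedSpace U0 := simply_retract U0inc U0ret U0ret_inc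
  exact ⟨isPathConnected_iff_pathConnectedSpace.2 inferInstance, h3⟩
end
end

section
/- The map τ ↦ N_τ, where N_τ is the bilinear map (ℝ³ ⊗ ℝ⁴) × (ℝ³ ⊗ ℝ⁴) → ℝ³ ⊗ ℝ⁴ determined on pure tensors by N_τ(x₁ ⊗ q₁, x₂ ⊗ q₂) := K(x₁, x₂) ⊗ τ(q₁, q₂), is an ℝ-linear bijection from the space of symmetric bilinear maps τ : ℝ⁴ × ℝ⁴ → ℝ⁴ onto the space of alternating bilinear maps N : (ℝ³ ⊗ ℝ⁴)² → ℝ³ ⊗ ℝ⁴ that are SO⁰(1,2)-equivariant, i.e. satisfy N(g·u₁, g·u₂) = g·N(u₁, u₂) for all g ∈ SO⁰(1,2). -/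
/- Statement 13: SO⁰(1,2)-equivariant alternating bilinear maps (ℝ³⊗ℝ⁴)² → ℝ³⊗ℝ⁴
correspond to symmetric bilinear maps ℝ⁴ × ℝ⁴ → ℝ⁴. -/

open Matrix TensorProduct

noncomputable section

/-- The real matrix η₃ = diag(-1,1,1). -/
def eta3 : Matrix (Fin 3) (Fin 3) ℝ := Matrix.diagonal ![-1, 1, 1]

/-- SO⁰(1,2): the identity component of {g : gᵀ η₃ g = η₃}. -/
def SOo12 : Set (Matrix (Fin 3) (Fin 3) ℝ) :=
  connectedComponentIn {g : Matrix (Fin 3) (Fin 3) ℝ | gᵀ * eta3 * g = eta3} 1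

/-- The Minkowski cross product K on ℝ^{1,2}, characterized by ⟨K(x,y),z⟩ = det(x|y|z). -/
def K (x y : Fin 3 → ℝ) : Fin 3 → ℝ :=
  ![-(x 1 * y 2 - x 2 * y 1), x 2 * y 0 - x 0 * y 2, x 0 * y 1 - x 1 * y 0]

/-- ℝ³ ⊗ ℝ⁴ as a real vector space. -/
abbrev T34 := TensorProduct ℝ (Fin 3 → ℝ) (Fin 4 → ℝ)

/-- A bilinear map ℝ⁴ × ℝ⁴ → ℝ⁴ is symmetric. -/
def IsSymm2 (τ : (Fin 4 → ℝ) →ₗ[ℝ] (Fin 4 → ℝ) →ₗ[ℝ] (Fin 4 → ℝ)) : Prop :=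
  ∀ a b : Fin 4 → ℝ, τ a b = τ b a

/-- The defining relation: N is determined on pure tensors by
N(x₁⊗q₁, x₂⊗q₂) = K(x₁,x₂) ⊗ τ(q₁,q₂). -/
def RelN (τ : (Fin 4 → ℝ) →ₗ[ℝ] (Fin 4 → ℝ) →ₗ[ℝ] (Fin 4 → ℝ))
    (N : AlternatingMap ℝ T34 T34 (Fin 2)) : Prop :=
  ∀ (x₁ x₂ : Fin 3 → ℝ) (q₁ q₂ : Fin 4 → ℝ),
    N ![x₁ ⊗ₜ[ℝ] q₁, x₂ ⊗ₜ[ℝ] q₂] = K x₁ x₂ ⊗ₜ[ℝ] τ q₁ q₂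

/-- N is SO⁰(1,2)-equivariant for the action g·(x ⊗ q) = (gx) ⊗ q. -/
def IsEquivN (N : AlternatingMap ℝ T34 T34 (Fin 2)) : Prop :=
  ∀ g ∈ SOo12, ∀ u : Fin 2 → T34,
    N (fun i => TensorProduct.map g.mulVecLin LinearMap.id (u i)) =
      TensorProduct.map g.mulVecLin LinearMap.id (N u)

set_option linter.all false

theorem mem_of_path (f : ℝ → Matrix (Fin 3) (Fin 3) ℝ) (hf : Continuous f) (h0 : f 0 = 1)
    (h : ∀ t, (f t)ᵀ * eta3 * f t = eta3) (t : ℝ) : f t ∈ SOo12 := by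
  have hp : IsPreconnected (Set.range f) := isPreconnected_range hf
  refine hp.subset_connectedComponentIn ⟨0, h0⟩ ?_ ⟨t, rfl⟩
  rintro _ ⟨s, rfl⟩
  exact h s

def rotM : Matrix (Fin 3) (Fin 3) ℝ := !![1, 0, 0; 0, 0, -1; 0, 1, 0]

def boostM : Matrix (Fin 3) (Fin 3) ℝ := !![5/4, 3/4, 0; 3/4, 5/4, 0; 0, 0, 1]

theorem rotM_mem : rotM ∈ SOo12 := by
  have := mem_of_path (fun t => !![1, 0, 0; 0, Real.cos t, -Real.sin t; 0, Real.sin t, Real.cos t])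
    (by
      refine continuous_matrix fun i j => ?_
      fin_cases i <;> fin_cases j <;> simp <;> fun_prop)
    (by ext i j; fin_cases i <;> fin_cases j <;> simp)
    (by
      intro t
      have := Real.sin_sq_add_cos_sq t
      ext i j
      fin_cases i <;> fin_cases j <;>
        simp [eta3, Matrix.mul_apply, Fin.sum_univ_three, Matrix.diagonal] <;> linarith)
    (Real.pi / 2)
  simpa [rotM] using this

theorem boostM_mem : boostM ∈ SOo12 := by
  have := mem_of_path (fun t => !![Real.cosh t, Real.sinh t, 0; Real.sinh t, Real.cosh t, 0; 0, 0, 1])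
    (by
      refine continuous_matrix fun i j => ?_
      fin_cases i <;> fin_cases j <;> simp <;>
        first | exact Real.continuous_cosh | exact Real.continuous_sinh | fun_prop)
    (by ext i j; fin_cases i <;> fin_cases j <;> simp)
    (by
      intro t
      have := Real.cosh_sq t
      ext i j
      fin_cases i <;> fin_cases j <;>
        simp [eta3, Matrix.mul_apply, Fin.sum_univ_three, Matrix.diagonal] <;> linarith)
    (Real.log 2)
  rw [Real.cosh_log (by norm_num), Real.sinh_log (by norm_num)] at this
  norm_num at this
  simpa [boostM] using this

theorem rel_of_mem {g : Matrix (Fin 3) (Fin 3) ℝ} (hg : g ∈ SOo12) : gᵀ * eta3 * g = eta3 :=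
  (connectedComponentIn_subset {g : Matrix (Fin 3) (Fin 3) ℝ | gᵀ * eta3 * g = eta3} 1) hg

theorem eta3_eq : eta3 = !![-1, 0, 0; 0, 1, 0; 0, 0, 1] := by
  ext i j; fin_cases i <;> fin_cases j <;> simp [eta3]

theorem eta3_det : eta3.det = -1 := by
  simp [eta3, Matrix.det_diagonal, Fin.prod_univ_three]

theorem det_sq {g : Matrix (Fin 3) (Fin 3) ℝ} (hg : gᵀ * eta3 * g = eta3) :
    g.det = 1 ∨ g.det = -1 := by
  have := congrArg Matrix.det hg
  rw [Matrix.det_mul, Matrix.det_mul, Matrix.det_transpose, eta3_det] at this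
  have h : g.det ^ 2 = 1 := by linarith
  exact sq_eq_one_iff.mp h

theorem det_of_mem {g : Matrix (Fin 3) (Fin 3) ℝ} (hg : g ∈ SOo12) : g.det = 1 := by
  have hone : (1 : Matrix (Fin 3) (Fin 3) ℝ) ∈
      {g : Matrix (Fin 3) (Fin 3) ℝ | gᵀ * eta3 * g = eta3} := by simp
  rcases det_sq (rel_of_mem hg) with h | h
  · exact h
  · exfalso
    have hc : IsPreconnected SOo12 := isPreconnected_connectedComponentIn
    have h1 : (1 : Matrix (Fin 3) (Fin 3) ℝ) ∈ SOo12 := mem_connectedComponentIn hone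
    have hd : ContinuousOn (fun m : Matrix (Fin 3) (Fin 3) ℝ => m.det) SOo12 :=
      (Continuous.matrix_det continuous_id).continuousOn
    have := hc.intermediate_value hg h1 hd
    obtain ⟨m, hm, hm0⟩ := this (show (0 : ℝ) ∈ Set.Icc _ _ by simp [h])
    rcases det_sq (rel_of_mem hm) with h' | h' <;> simp only [h'] at hm0 <;> norm_num at hm0

theorem K_aux (g : Matrix (Fin 3) (Fin 3) ℝ) (x y : Fin 3 → ℝ) :
    (gᵀ * eta3) *ᵥ K (g *ᵥ x) (g *ᵥ y) = g.det • (eta3 *ᵥ K x y) := by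
  ext i
  fin_cases i <;>
    simp [eta3_eq, K, Matrix.mulVec, dotProduct, Matrix.mul_apply, Fin.sum_univ_three,
      Matrix.det_fin_three] <;> ring

theorem K_equiv {g : Matrix (Fin 3) (Fin 3) ℝ} (hg : g ∈ SOo12) (x y : Fin 3 → ℝ) :
    K (g *ᵥ x) (g *ᵥ y) = g *ᵥ K x y := by
  have h := K_aux g x y
  rw [det_of_mem hg, one_smul] at h
  have h2 : (gᵀ * eta3) *ᵥ (g *ᵥ K x y) = eta3 *ᵥ K x y := by
    rw [Matrix.mulVec_mulVec, rel_of_mem hg]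
  refine Matrix.mulVec_injective_of_isUnit (A := gᵀ * eta3) ?_ (h.trans h2.symm)
  rw [Matrix.isUnit_iff_isUnit_det, Matrix.det_mul, Matrix.det_transpose, det_of_mem hg, eta3_det]
  norm_num

/-- `K` as a bilinear map. -/
def Klin : (Fin 3 → ℝ) →ₗ[ℝ] (Fin 3 → ℝ) →ₗ[ℝ] (Fin 3 → ℝ) :=
  LinearMap.mk₂ ℝ K
    (by intro x y z; ext i; fin_cases i <;> simp [K] <;> ring)
    (by intro c x y; ext i; fin_cases i <;> simp [K] <;> ring)
    (by intro x y z; ext i; fin_cases i <;> simp [K] <;> ring)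
    (by intro c x y; ext i; fin_cases i <;> simp [K] <;> ring)

theorem Klin_apply (x y : Fin 3 → ℝ) : Klin x y = K x y := rfl

theorem K_antisymm (x y : Fin 3 → ℝ) : K y x = - K x y := by
  ext i; fin_cases i <;> simp [K] <;> ring

theorem upd0 (x z w : T34) : Function.update ![x, z] 0 w = ![w, z] := by
  ext i; fin_cases i <;> simp

theorem upd1 (x z w : T34) : Function.update ![x, z] 1 w = ![x, w] := by
  ext i; fin_cases i <;> simp

/-- an alternating map as bilinear map. -/
def NB (N : AlternatingMap ℝ T34 T34 (Fin 2)) : T34 →ₗ[ℝ] T34 →ₗ[ℝ] T34 :=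
  LinearMap.mk₂ ℝ (fun u v => N ![u, v])
    (by intro x y z; have := N.map_update_add ![x, z] 0 x y; simp only [upd0] at this; exact this)
    (by intro c x y; have := N.map_update_smul ![x, y] 0 c x; simp only [upd0] at this; exact this)
    (by intro x y z; have := N.map_update_add ![x, y] 1 y z; simp only [upd1] at this; exact this)
    (by intro c x y; have := N.map_update_smul ![x, y] 1 c y; simp only [upd1] at this; exact this)

theorem NB_apply (N : AlternatingMap ℝ T34 T34 (Fin 2)) (u v : T34) : NB N u v = N ![u, v] := rfl

theorem N_swap (N : AlternatingMap ℝ T34 T34 (Fin 2)) (u v : T34) : N ![v, u] = - N ![u, v] := by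
  rw [← N.map_swap ![u, v] (show (0 : Fin 2) ≠ 1 by decide)]
  congr 1
  ext i; fin_cases i <;> simp

/-- an alternating bilinear map as an `AlternatingMap`. -/
def mkAlt (B : T34 →ₗ[ℝ] T34 →ₗ[ℝ] T34) (h : ∀ u, B u u = 0) :
    AlternatingMap ℝ T34 T34 (Fin 2) :=
  AlternatingMap.mk
    (MultilinearMap.mk' (fun u => B (u 0) (u 1))
      (by intro m i x y; fin_cases i <;> simp)
      (by intro m i c x; fin_cases i <;> simp))
    (by
      intro v i j hv hij
      have : v 0 = v 1 := by
        fin_cases i <;> fin_cases j <;> simp_all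
      simp [this, h])

theorem mkAlt_apply (B : T34 →ₗ[ℝ] T34 →ₗ[ℝ] T34) (h : ∀ u, B u u = 0) (u : Fin 2 → T34) :
    mkAlt B h u = B (u 0) (u 1) := rfl

theorem NB_of_rel {τ : (Fin 4 → ℝ) →ₗ[ℝ] (Fin 4 → ℝ) →ₗ[ℝ] (Fin 4 → ℝ)}
    {N : AlternatingMap ℝ T34 T34 (Fin 2)} (h : RelN τ N) : NB N = TensorProduct.map₂ Klin τ := by
  refine TensorProduct.ext' fun x q => ?_
  refine TensorProduct.ext' fun y r => ?_
  rw [NB_apply, h, TensorProduct.map₂_apply_tmul, TensorProduct.map_tmul, Klin_apply]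

theorem eta_two (u : Fin 2 → T34) : u = ![u 0, u 1] := by
  ext i; fin_cases i <;> rfl

theorem map2_antisymm {τ : (Fin 4 → ℝ) →ₗ[ℝ] (Fin 4 → ℝ) →ₗ[ℝ] (Fin 4 → ℝ)} (hτ : IsSymm2 τ)
    (u v : T34) : TensorProduct.map₂ Klin τ u v + TensorProduct.map₂ Klin τ v u = 0 := by
  induction u using TensorProduct.induction_on with
  | zero => simp
  | add a b ha hb =>
    simp only [map_add, LinearMap.add_apply]
    rw [add_add_add_comm, ha, hb, add_zero]
  | tmul x q =>
    induction v using TensorProduct.induction_on with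
    | zero => simp
    | add a b ha hb =>
      simp only [map_add, LinearMap.add_apply]
      rw [add_add_add_comm, ha, hb, add_zero]
    | tmul y r =>
      simp only [TensorProduct.map₂_apply_tmul, TensorProduct.map_tmul, Klin_apply]
      rw [hτ r q, ← TensorProduct.add_tmul, K_antisymm x y, add_neg_cancel, TensorProduct.zero_tmul]

theorem map2_self {τ : (Fin 4 → ℝ) →ₗ[ℝ] (Fin 4 → ℝ) →ₗ[ℝ] (Fin 4 → ℝ)} (hτ : IsSymm2 τ)
    (u : T34) : TensorProduct.map₂ Klin τ u u = 0 := by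
  have h := map2_antisymm hτ u u
  rw [← two_smul ℝ] at h
  exact (smul_eq_zero.mp h).resolve_left two_ne_zero

theorem map2_equiv (τ : (Fin 4 → ℝ) →ₗ[ℝ] (Fin 4 → ℝ) →ₗ[ℝ] (Fin 4 → ℝ))
    {g : Matrix (Fin 3) (Fin 3) ℝ} (hg : g ∈ SOo12) (u v : T34) :
    TensorProduct.map₂ Klin τ (TensorProduct.map g.mulVecLin LinearMap.id u)
      (TensorProduct.map g.mulVecLin LinearMap.id v) =
    TensorProduct.map g.mulVecLin LinearMap.id (TensorProduct.map₂ Klin τ u v) := by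
  induction u using TensorProduct.induction_on with
  | zero => simp
  | add a b ha hb => simp only [map_add, LinearMap.add_apply, ha, hb]
  | tmul x q =>
    induction v using TensorProduct.induction_on with
    | zero => simp
    | add a b ha hb => simp only [map_add, ha, hb]
    | tmul y r =>
      simp [Klin_apply, K_equiv hg]

/-- contraction against the k-th coordinate of ℝ⁴. -/
def ctr (k : Fin 4) : T34 →ₗ[ℝ] (Fin 3 → ℝ) :=
  (TensorProduct.rid ℝ (Fin 3 → ℝ)).toLinearMap ∘ₗ
    TensorProduct.map LinearMap.id (LinearMap.proj k)

theorem ctr_tmul (k : Fin 4) (x : Fin 3 → ℝ) (q : Fin 4 → ℝ) : ctr k (x ⊗ₜ[ℝ] q) = q k • x := by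
  simp [ctr]

theorem ctr_equiv (k : Fin 4) (g : Matrix (Fin 3) (Fin 3) ℝ) (t : T34) :
    ctr k (TensorProduct.map g.mulVecLin LinearMap.id t) = g *ᵥ ctr k t := by
  induction t using TensorProduct.induction_on with
  | zero => simp
  | add a b ha hb => simp only [map_add, ha, hb, Matrix.mulVec_add]
  | tmul x q => simp [ctr_tmul, Matrix.mulVec_smul]

theorem ctr_sum (t : T34) : t = ∑ k, ctr k t ⊗ₜ[ℝ] (Pi.single k 1 : Fin 4 → ℝ) := by
  induction t using TensorProduct.induction_on with
  | zero => simp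
  | add a b ha hb =>
    simp only [map_add, TensorProduct.add_tmul, Finset.sum_add_distrib]
    rw [← ha, ← hb]
  | tmul x q =>
    simp only [ctr_tmul, TensorProduct.smul_tmul]
    rw [← TensorProduct.tmul_sum]
    congr 1
    exact pi_eq_sum_univ' q

theorem ctr_ext {s t : T34} (h : ∀ k, ctr k s = ctr k t) : s = t := by
  rw [ctr_sum s, ctr_sum t]
  simp [h]

/-- contraction against the last coordinate of ℝ³. -/
def ctl : T34 →ₗ[ℝ] (Fin 4 → ℝ) :=
  LinearMap.pi fun k => LinearMap.proj 2 ∘ₗ ctr k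

theorem ctl_apply (t : T34) (k : Fin 4) : ctl t k = ctr k t 2 := rfl

theorem ctl_tmul (x : Fin 3 → ℝ) (q : Fin 4 → ℝ) : ctl (x ⊗ₜ[ℝ] q) = x 2 • q := by
  ext k; simp [ctl_apply, ctr_tmul, mul_comm]

def e0 : Fin 3 → ℝ := ![1, 0, 0]
def e1 : Fin 3 → ℝ := ![0, 1, 0]
def e2 : Fin 3 → ℝ := ![0, 0, 1]

theorem vec_eq (x : Fin 3 → ℝ) : x = x 0 • e0 + x 1 • e1 + x 2 • e2 := by
  ext i; fin_cases i <;> simp [e0, e1, e2]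

set_option maxHeartbeats 2000000 in
theorem schur (b : (Fin 3 → ℝ) →ₗ[ℝ] (Fin 3 → ℝ) →ₗ[ℝ] (Fin 3 → ℝ))
    (hr : ∀ x y, b (rotM *ᵥ x) (rotM *ᵥ y) = rotM *ᵥ b x y)
    (hb : ∀ x y, b (boostM *ᵥ x) (boostM *ᵥ y) = boostM *ᵥ b x y) (x y : Fin 3 → ℝ) :
    b x y = b e0 e1 2 • K x y := by
  have r0 : rotM *ᵥ e0 = e0 := by
    ext i; fin_cases i <;> simp [e0, e1, e2, rotM, Matrix.mulVec, dotProduct, Fin.sum_univ_three]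
  have r1 : rotM *ᵥ e1 = e2 := by
    ext i; fin_cases i <;> simp [e0, e1, e2, rotM, Matrix.mulVec, dotProduct, Fin.sum_univ_three]
  have r2 : rotM *ᵥ e2 = -e1 := by
    ext i; fin_cases i <;> simp [e0, e1, e2, rotM, Matrix.mulVec, dotProduct, Fin.sum_univ_three]
  have b0 : boostM *ᵥ e0 = (5/4 : ℝ) • e0 + (3/4 : ℝ) • e1 := by
    ext i; fin_cases i <;> simp [e0, e1, e2, boostM, Matrix.mulVec, dotProduct, Fin.sum_univ_three]
  have b1 : boostM *ᵥ e1 = (3/4 : ℝ) • e0 + (5/4 : ℝ) • e1 := by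
    ext i; fin_cases i <;> simp [e0, e1, e2, boostM, Matrix.mulVec, dotProduct, Fin.sum_univ_three]
  have b2 : boostM *ᵥ e2 = e2 := by
    ext i; fin_cases i <;> simp [e0, e1, e2, boostM, Matrix.mulVec, dotProduct, Fin.sum_univ_three]
  have rv : ∀ v : Fin 3 → ℝ, rotM *ᵥ v = ![v 0, -v 2, v 1] := by
    intro v; ext i; fin_cases i <;> simp [rotM, Matrix.mulVec, dotProduct, Fin.sum_univ_three]
  have bv : ∀ v : Fin 3 → ℝ, boostM *ᵥ v = ![5/4 * v 0 + 3/4 * v 1, 3/4 * v 0 + 5/4 * v 1, v 2] := by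
    intro v; ext i; fin_cases i <;> simp [boostM, Matrix.mulVec, dotProduct, Fin.sum_univ_three]
  have rh00 := hr e0 e0
  simp only [r0, rv] at rh00
  try simp only [map_add, map_smul, map_neg, LinearMap.add_apply, LinearMap.smul_apply, LinearMap.neg_apply] at rh00
  have rh01 := hr e0 e1
  simp only [r0, r1, rv] at rh01
  try simp only [map_add, map_smul, map_neg, LinearMap.add_apply, LinearMap.smul_apply, LinearMap.neg_apply] at rh01
  have rh02 := hr e0 e2
  simp only [r0, r2, rv] at rh02
  try simp only [map_add, map_smul, map_neg, LinearMap.add_apply, LinearMap.smul_apply, LinearMap.neg_apply] at rh02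
  have rh10 := hr e1 e0
  simp only [r1, r0, rv] at rh10
  try simp only [map_add, map_smul, map_neg, LinearMap.add_apply, LinearMap.smul_apply, LinearMap.neg_apply] at rh10
  have rh11 := hr e1 e1
  simp only [r1, rv] at rh11
  try simp only [map_add, map_smul, map_neg, LinearMap.add_apply, LinearMap.smul_apply, LinearMap.neg_apply] at rh11
  have rh12 := hr e1 e2
  simp only [r1, r2, rv] at rh12
  try simp only [map_add, map_smul, map_neg, LinearMap.add_apply, LinearMap.smul_apply, LinearMap.neg_apply] at rh12
  have rh20 := hr e2 e0
  simp only [r2, r0, rv] at rh20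
  try simp only [map_add, map_smul, map_neg, LinearMap.add_apply, LinearMap.smul_apply, LinearMap.neg_apply] at rh20
  have rh21 := hr e2 e1
  simp only [r2, r1, rv] at rh21
  try simp only [map_add, map_smul, map_neg, LinearMap.add_apply, LinearMap.smul_apply, LinearMap.neg_apply] at rh21
  have rh22 := hr e2 e2
  simp only [r2, rv] at rh22
  try simp only [map_add, map_smul, map_neg, LinearMap.add_apply, LinearMap.smul_apply, LinearMap.neg_apply] at rh22
  have bh00 := hb e0 e0
  simp only [b0, bv] at bh00
  try simp only [map_add, map_smul, map_neg, LinearMap.add_apply, LinearMap.smul_apply, LinearMap.neg_apply] at bh00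
  have bh01 := hb e0 e1
  simp only [b0, b1, bv] at bh01
  try simp only [map_add, map_smul, map_neg, LinearMap.add_apply, LinearMap.smul_apply, LinearMap.neg_apply] at bh01
  have bh02 := hb e0 e2
  simp only [b0, b2, bv] at bh02
  try simp only [map_add, map_smul, map_neg, LinearMap.add_apply, LinearMap.smul_apply, LinearMap.neg_apply] at bh02
  have bh10 := hb e1 e0
  simp only [b1, b0, bv] at bh10
  try simp only [map_add, map_smul, map_neg, LinearMap.add_apply, LinearMap.smul_apply, LinearMap.neg_apply] at bh10
  have bh11 := hb e1 e1
  simp only [b1, bv] at bh11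
  try simp only [map_add, map_smul, map_neg, LinearMap.add_apply, LinearMap.smul_apply, LinearMap.neg_apply] at bh11
  have bh12 := hb e1 e2
  simp only [b1, b2, bv] at bh12
  try simp only [map_add, map_smul, map_neg, LinearMap.add_apply, LinearMap.smul_apply, LinearMap.neg_apply] at bh12
  have bh20 := hb e2 e0
  simp only [b2, b0, bv] at bh20
  try simp only [map_add, map_smul, map_neg, LinearMap.add_apply, LinearMap.smul_apply, LinearMap.neg_apply] at bh20
  have bh21 := hb e2 e1
  simp only [b2, b1, bv] at bh21
  try simp only [map_add, map_smul, map_neg, LinearMap.add_apply, LinearMap.smul_apply, LinearMap.neg_apply] at bh21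
  have bh22 := hb e2 e2
  simp only [b2, bv] at bh22
  try simp only [map_add, map_smul, map_neg, LinearMap.add_apply, LinearMap.smul_apply, LinearMap.neg_apply] at bh22
  simp only [funext_iff, Fin.forall_fin_succ, IsEmpty.forall_iff, and_true, Pi.add_apply, Pi.smul_apply, Pi.neg_apply, smul_eq_mul, Matrix.cons_val_zero, Matrix.cons_val_succ, Fin.succ_zero_eq_one, Fin.succ_one_eq_two, smul_add] at rh00 rh01 rh02 rh10 rh11 rh12 rh20 rh21 rh22 bh00 bh01 bh02 bh10 bh11 bh12 bh20 bh21 bh22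
  obtain ⟨rh000, rh001, rh002⟩ := rh00
  obtain ⟨rh010, rh011, rh012⟩ := rh01
  obtain ⟨rh020, rh021, rh022⟩ := rh02
  obtain ⟨rh100, rh101, rh102⟩ := rh10
  obtain ⟨rh110, rh111, rh112⟩ := rh11
  obtain ⟨rh120, rh121, rh122⟩ := rh12
  obtain ⟨rh200, rh201, rh202⟩ := rh20
  obtain ⟨rh210, rh211, rh212⟩ := rh21
  obtain ⟨rh220, rh221, rh222⟩ := rh22
  obtain ⟨bh000, bh001, bh002⟩ := bh00
  obtain ⟨bh010, bh011, bh012⟩ := bh01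
  obtain ⟨bh020, bh021, bh022⟩ := bh02
  obtain ⟨bh100, bh101, bh102⟩ := bh10
  obtain ⟨bh110, bh111, bh112⟩ := bh11
  obtain ⟨bh120, bh121, bh122⟩ := bh12
  obtain ⟨bh200, bh201, bh202⟩ := bh20
  obtain ⟨bh210, bh211, bh212⟩ := bh21
  obtain ⟨bh220, bh221⟩ := bh22
  have c000 : b e0 e0 0 = 0 := by linear_combination (-15/28) * rh001 + (15/28) * rh002 + (-15/28) * rh010 + (-15/28) * rh020 + (15/28) * rh100 + (27/28) * rh112 + (15/28) * rh200 + (-27/28) * rh221 + (25/14) * bh000 + (-27/14) * bh001 + (-15/14) * bh010 + (45/14) * bh011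
  have c001 : b e0 e0 1 = 0 := by linear_combination (1/2) * rh001 + (-1/2) * rh002
  have c002 : b e0 e0 2 = 0 := by linear_combination (1/2) * rh001 + (1/2) * rh002
  have c010 : b e0 e1 0 = 0 := by linear_combination (-1/2) * rh010 + (-1/2) * rh020
  have c011 : b e0 e1 1 = 0 := by linear_combination (15/28) * rh001 + (-15/28) * rh002 + (15/28) * rh010 + (15/28) * rh020 + (27/28) * rh100 + (15/28) * rh112 + (27/28) * rh200 + (-15/28) * rh221 + (45/14) * bh000 + (-15/14) * bh001 + (-27/14) * bh010 + (25/14) * bh011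
  have c020 : b e0 e2 0 = 0 := by linear_combination (1/2) * rh010 + (-1/2) * rh020
  have c021 : b e0 e2 1 = -b e0 e1 2 := by linear_combination (1) * rh011
  have c022 : b e0 e2 2 = 0 := by linear_combination (15/28) * rh001 + (-15/28) * rh002 + (15/28) * rh010 + (1) * rh012 + (15/28) * rh020 + (27/28) * rh100 + (15/28) * rh112 + (27/28) * rh200 + (-15/28) * rh221 + (45/14) * bh000 + (-15/14) * bh001 + (-27/14) * bh010 + (25/14) * bh011
  have c100 : b e1 e0 0 = 0 := by linear_combination (-1/2) * rh100 + (-1/2) * rh200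
  have c101 : b e1 e0 1 = 0 := by linear_combination (-95/84) * rh001 + (95/84) * rh002 + (-27/28) * rh010 + (-27/28) * rh020 + (-15/28) * rh100 + (15/28) * rh112 + (-15/28) * rh200 + (-15/28) * rh221 + (-25/14) * bh000 + (25/42) * bh001 + (15/14) * bh010 + (11/14) * bh011
  have c102 : b e1 e0 2 = -b e0 e1 2 := by linear_combination (-3/10) * rh001 + (-3/10) * rh002 + (-3/10) * rh111 + (-3/10) * rh222 + (16/15) * bh002
  have c110 : b e1 e1 0 = 0 := by linear_combination (27/28) * rh001 + (-27/28) * rh002 + (95/84) * rh010 + (95/84) * rh020 + (15/28) * rh100 + (-15/28) * rh112 + (15/28) * rh200 + (15/28) * rh221 + (11/14) * bh000 + (15/14) * bh001 + (25/42) * bh010 + (-25/14) * bh011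
  have c111 : b e1 e1 1 = 0 := by linear_combination (-1/2) * rh112 + (1/2) * rh221
  have c112 : b e1 e1 2 = 0 := by linear_combination (1/2) * rh111 + (1/2) * rh222
  have c120 : b e1 e2 0 = -b e0 e1 2 := by linear_combination (1) * rh011 + (4/3) * bh020
  have c121 : b e1 e2 1 = 0 := by linear_combination (-1/2) * rh122 + (-1/2) * rh211
  have c122 : b e1 e2 2 = 0 := by linear_combination (1/2) * rh121 + (-1/2) * rh212
  have c200 : b e2 e0 0 = 0 := by linear_combination (1/2) * rh100 + (-1/2) * rh200
  have c201 : b e2 e0 1 = b e0 e1 2 := by linear_combination (3/10) * rh001 + (3/10) * rh002 + (1) * rh101 + (3/10) * rh111 + (3/10) * rh222 + (-16/15) * bh002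
  have c202 : b e2 e0 2 = 0 := by linear_combination (-95/84) * rh001 + (95/84) * rh002 + (-27/28) * rh010 + (-27/28) * rh020 + (-15/28) * rh100 + (1) * rh102 + (15/28) * rh112 + (-15/28) * rh200 + (-15/28) * rh221 + (-25/14) * bh000 + (25/42) * bh001 + (15/14) * bh010 + (11/14) * bh011
  have c210 : b e2 e1 0 = b e0 e1 2 := by linear_combination (-1) * rh011 + (-1) * rh120 + (-4/3) * bh020
  have c211 : b e2 e1 1 = 0 := by linear_combination (-1/2) * rh121 + (-1/2) * rh212
  have c212 : b e2 e1 2 = 0 := by linear_combination (-1/2) * rh122 + (1/2) * rh211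
  have c220 : b e2 e2 0 = 0 := by linear_combination (27/28) * rh001 + (-27/28) * rh002 + (95/84) * rh010 + (95/84) * rh020 + (15/28) * rh100 + (1) * rh110 + (-15/28) * rh112 + (15/28) * rh200 + (15/28) * rh221 + (11/14) * bh000 + (15/14) * bh001 + (25/42) * bh010 + (-25/14) * bh011
  have c221 : b e2 e2 1 = 0 := by linear_combination (1/2) * rh111 + (-1/2) * rh222
  have c222 : b e2 e2 2 = 0 := by linear_combination (1/2) * rh112 + (1/2) * rh221
  have hx := vec_eq x
  have hy := vec_eq y
  have key : ∀ i, b x y i = x 0 * y 0 * b e0 e0 i + x 0 * y 1 * b e0 e1 i + x 0 * y 2 * b e0 e2 i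
      + x 1 * y 0 * b e1 e0 i + x 1 * y 1 * b e1 e1 i + x 1 * y 2 * b e1 e2 i
      + x 2 * y 0 * b e2 e0 i + x 2 * y 1 * b e2 e1 i + x 2 * y 2 * b e2 e2 i := by
    intro i
    conv_lhs => rw [hx, hy]
    simp only [map_add, map_smul, LinearMap.add_apply, LinearMap.smul_apply, Pi.add_apply,
      Pi.smul_apply, smul_eq_mul]
    ring
  ext i
  rw [key]
  fin_cases i
  · change _ = b e0 e1 2 * (-(x 1 * y 2 - x 2 * y 1))
    simp only [Fin.zero_eta, Fin.mk_one, Fin.reduceFinMk, c000, c010, c020, c100, c110, c120, c200, c210, c220]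
    ring
  · change _ = b e0 e1 2 * (x 2 * y 0 - x 0 * y 2)
    simp only [Fin.zero_eta, Fin.mk_one, Fin.reduceFinMk, c001, c011, c021, c101, c111, c121, c201, c211, c221]
    ring
  · change _ = b e0 e1 2 * (x 0 * y 1 - x 1 * y 0)
    simp only [Fin.zero_eta, Fin.mk_one, Fin.reduceFinMk, c002, c022, c102, c112, c122, c202, c212, c222]
    ring

/-- τ ↦ N_τ is an ℝ-linear bijection from symmetric bilinear maps ℝ⁴ × ℝ⁴ → ℝ⁴ onto
SO⁰(1,2)-equivariant alternating bilinear maps (ℝ³⊗ℝ⁴)² → ℝ³⊗ℝ⁴. -/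
theorem symmetric_bilinear_equiv_equivariant_alternating :
    -- N_τ is well defined (exists and is unique) for every symmetric τ …
    (∀ τ, IsSymm2 τ → ∃! N : AlternatingMap ℝ T34 T34 (Fin 2), RelN τ N) ∧
    -- … and is SO⁰(1,2)-equivariant,
    (∀ τ, IsSymm2 τ → ∀ N, RelN τ N → IsEquivN N) ∧
    -- the correspondence is ℝ-linear,
    (∀ τ τ' N N', RelN τ N → RelN τ' N' → RelN (τ + τ') (N + N')) ∧
    (∀ (c : ℝ) τ N, RelN τ N → RelN (c • τ) (c • N)) ∧
    -- and it is onto the equivariant alternating maps, with a unique symmetric preimage.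
    (∀ N, IsEquivN N → ∃! τ, IsSymm2 τ ∧ RelN τ N) := by
  refine ⟨?_, ?_, ?_, ?_, ?_⟩
  · intro τ hτ
    refine ⟨mkAlt (TensorProduct.map₂ Klin τ) (map2_self hτ), ?_, ?_⟩
    · intro x₁ x₂ q₁ q₂
      simp [mkAlt_apply, Klin_apply]
    · intro N hN
      ext u
      rw [mkAlt_apply, ← NB_of_rel hN, NB_apply, ← eta_two u]
  · intro τ _ N hN g hg u
    have h : ∀ v : Fin 2 → T34, N v = TensorProduct.map₂ Klin τ (v 0) (v 1) := by
      intro v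
      rw [← NB_of_rel hN, NB_apply, ← eta_two v]
    rw [h, h, map2_equiv τ hg]
  · intro τ τ' N N' h h' x₁ x₂ q₁ q₂
    simp [h x₁ x₂ q₁ q₂, h' x₁ x₂ q₁ q₂, TensorProduct.tmul_add]
  · intro c τ N h x₁ x₂ q₁ q₂
    simp [h x₁ x₂ q₁ q₂]
  · intro N hN
    have hK : K e0 e1 2 = 1 := by simp [K, e0, e1]
    let τ : (Fin 4 → ℝ) →ₗ[ℝ] (Fin 4 → ℝ) →ₗ[ℝ] (Fin 4 → ℝ) :=
      ((NB N).compl₁₂ (TensorProduct.mk ℝ _ _ e0) (TensorProduct.mk ℝ _ _ e1)).compr₂ ctl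
    have hτ : ∀ q r, τ q r = ctl (N ![e0 ⊗ₜ[ℝ] q, e1 ⊗ₜ[ℝ] r]) := fun q r => rfl
    have hrel : RelN τ N := by
      intro x₁ x₂ q₁ q₂
      refine ctr_ext fun k => ?_
      let b : (Fin 3 → ℝ) →ₗ[ℝ] (Fin 3 → ℝ) →ₗ[ℝ] (Fin 3 → ℝ) :=
        ((NB N).compl₁₂ ((TensorProduct.mk ℝ _ _).flip q₁)
          ((TensorProduct.mk ℝ _ _).flip q₂)).compr₂ (ctr k)
      have hb : ∀ x y, b x y = ctr k (N ![x ⊗ₜ[ℝ] q₁, y ⊗ₜ[ℝ] q₂]) := fun x y => rfl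
      have hg : ∀ g ∈ SOo12, ∀ x y, b (g *ᵥ x) (g *ᵥ y) = g *ᵥ b x y := by
        intro g hg x y
        rw [hb, hb, ← ctr_equiv, ← hN g hg]
        congr 2
        ext i; fin_cases i <;> simp
      have := schur b (hg _ rotM_mem) (hg _ boostM_mem) x₁ x₂
      rw [hb, hb] at this
      rw [this, ctr_tmul, hτ, ctl_apply]
    refine ⟨τ, ⟨?_, hrel⟩, ?_⟩
    · intro q r
      rw [hτ r q, N_swap, hrel, map_neg, ctl_tmul]
      simp [K, e0, e1]
    · rintro σ ⟨_, hσ⟩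
      refine LinearMap.ext₂ fun q r => ?_
      rw [hτ, hσ, ctl_tmul, hK, one_smul]
end
end
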